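/- arXiv:1508.01308 — 12 statements merged into one kernel-verified Lean document; each statement's English description precedes it below -/
import Mathlib

section
/- Let N, M, C be positive natural numbers. Let ‖·‖_b be a norm on the space of real M×C matrices and ‖·‖_a a norm on ℝ^N, and let ‖·‖_{b*} and ‖·‖_{a*} denote their dual norms. Assume that ‖·‖_{a*} is absolute, i.e. ‖v‖_{a*} = ‖|v|‖_{a*} for every v ∈ ℝ^N, where |v| is the componentwise absolute value. Then for every tensor A ∈ ℝ^{N×M×C}, the supremum of the Frobenius inner product ⟨A,B⟩ over all tensors B ∈ ℝ^{N×M×C} satisfying ‖B‖_{b*,a*} ≤ 1 equals ‖A‖_{b,a}. In other words, the dual norm of the collaborative norm ‖·‖_{b,a} is the collaborative norm ‖·‖_{b*,a*} built from the dual norms. -/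
/-- Dual norm of a norm on `ℝ^N`, w.r.t. the standard inner product. -/
noncomputable def dualNormVec {N : ℕ} (na : (Fin N → ℝ) → ℝ) (x : Fin N → ℝ) : ℝ :=
  sSup {r : ℝ | ∃ y : Fin N → ℝ, na y ≤ 1 ∧ r = ∑ i, x i * y i}

/-- Dual norm of a norm on real `M × C` matrices, w.r.t. the Frobenius inner product. -/
noncomputable def dualNormMat {M C : ℕ} (nb : (Fin M → Fin C → ℝ) → ℝ)
    (x : Fin M → Fin C → ℝ) : ℝ :=
  sSup {r : ℝ | ∃ y : Fin M → Fin C → ℝ, nb y ≤ 1 ∧ r = ∑ j, ∑ k, x j k * y j k}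

/-- Collaborative norm of a tensor: apply `nb` to each matrix slice, then `na`. -/
noncomputable def collabNorm {N M C : ℕ} (nb : (Fin M → Fin C → ℝ) → ℝ)
    (na : (Fin N → ℝ) → ℝ) (A : Fin N → Fin M → Fin C → ℝ) : ℝ :=
  na (fun i => nb (A i))

/-- Frobenius inner product of two tensors. -/
noncomputable def tinner {N M C : ℕ} (A B : Fin N → Fin M → Fin C → ℝ) : ℝ :=
  ∑ i, ∑ j, ∑ k, A i j k * B i j k

/-- Norm axioms on a finite-dimensional space: linear functionals are bounded, and norming
functionals exist. -/
theorem norm_facts {V : Type} [AddCommGroup V] [Module ℝ V] [FiniteDimensional ℝ V]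
    (n : V → ℝ) (h0 : ∀ x, 0 ≤ n x) (hadd : ∀ x y, n (x + y) ≤ n x + n y)
    (hsmul : ∀ (c : ℝ) x, n (c • x) = |c| * n x) (hdef : ∀ x, n x = 0 → x = 0) :
    (∀ f : V →ₗ[ℝ] ℝ, ∃ K : ℝ, ∀ y, |f y| ≤ K * n y) ∧
    (∀ x, ∃ f : V →ₗ[ℝ] ℝ, f x = n x ∧ ∀ y, f y ≤ n y) := by
  let : Norm V := ⟨n⟩
  have core : NormedSpace.Core ℝ V :=
    { norm_nonneg := h0
      norm_smul := fun c x => hsmul c x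
      norm_triangle := hadd
      norm_eq_zero_iff := fun x => ⟨hdef x, fun h => by
        have := hsmul 0 x
        subst h
        have h2 : n 0 = 0 := by simpa using this
        exact h2⟩ }
  let : NormedAddCommGroup V := NormedAddCommGroup.ofCore core
  let : NormedSpace ℝ V := NormedSpace.ofCore core
  refine ⟨fun f => ⟨‖LinearMap.toContinuousLinearMap f‖, fun y =>
    (LinearMap.toContinuousLinearMap f).le_opNorm y⟩, fun x => ?_⟩
  obtain ⟨g, hg, hgx⟩ := exists_dual_vector'' ℝ x
  refine ⟨g.toLinearMap, hgx, fun y => ?_⟩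
  have h1 := g.le_opNorm y
  have h2 : ‖g‖ * ‖y‖ ≤ 1 * ‖y‖ := mul_le_mul_of_nonneg_right hg (norm_nonneg y)
  have h3 : g y ≤ ‖g y‖ := le_abs_self _
  have h4 : g y ≤ ‖y‖ := by linarith
  exact h4

/-- Generic Hoelder inequality and bound for the dual norm. -/
theorem dual_holder {V : Type} [AddCommGroup V] [Module ℝ V] [FiniteDimensional ℝ V]
    (n : V → ℝ) (h0 : ∀ x, 0 ≤ n x) (hadd : ∀ x y, n (x + y) ≤ n x + n y)
    (hsmul : ∀ (c : ℝ) x, n (c • x) = |c| * n x) (hdef : ∀ x, n x = 0 → x = 0)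
    (f : V →ₗ[ℝ] ℝ) (y : V) :
    f y ≤ n y * sSup {r : ℝ | ∃ y, n y ≤ 1 ∧ r = f y} := by
  obtain ⟨K, hK⟩ := (norm_facts n h0 hadd hsmul hdef).1 f
  have hbd : BddAbove {r : ℝ | ∃ y, n y ≤ 1 ∧ r = f y} := by
    refine ⟨|K|, ?_⟩
    rintro r ⟨y, hy, rfl⟩
    calc f y ≤ |f y| := le_abs_self _
      _ ≤ K * n y := hK y
      _ ≤ |K| * 1 := mul_le_mul (le_abs_self K) hy (h0 y) (abs_nonneg K)
      _ = |K| := mul_one _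
  rcases (h0 y).eq_or_lt with h | h
  · have := hdef y h.symm
    rw [← h, this]; simp
  · have h1 : f ((n y)⁻¹ • y) ≤ sSup {r : ℝ | ∃ y, n y ≤ 1 ∧ r = f y} := by
      refine le_csSup hbd ⟨_, ?_, rfl⟩
      rw [hsmul, abs_of_pos (inv_pos.2 h), inv_mul_cancel₀ h.ne']
    rw [map_smul, smul_eq_mul, inv_mul_le_iff₀ h] at h1
    exact h1

/-- The functional on vectors given by pairing. -/
def vecFun {N : ℕ} (x : Fin N → ℝ) : (Fin N → ℝ) →ₗ[ℝ] ℝ where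
  toFun y := ∑ i, x i * y i
  map_add' y z := by simp [mul_add, Finset.sum_add_distrib]
  map_smul' c y := by
    simp only [Pi.smul_apply, smul_eq_mul, RingHom.id_apply, Finset.mul_sum]
    exact Finset.sum_congr rfl fun i _ => by ring

/-- The functional on matrices given by pairing. -/
def matFun {M C : ℕ} (x : Fin M → Fin C → ℝ) : (Fin M → Fin C → ℝ) →ₗ[ℝ] ℝ where
  toFun y := ∑ j, ∑ k, x j k * y j k
  map_add' y z := by simp [mul_add, Finset.sum_add_distrib]
  map_smul' c y := by
    simp only [Pi.smul_apply, smul_eq_mul, RingHom.id_apply, Finset.mul_sum]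
    exact Finset.sum_congr rfl fun i _ => Finset.sum_congr rfl fun k _ => by ring

theorem vecFun_surj {N : ℕ} (f : (Fin N → ℝ) →ₗ[ℝ] ℝ) : ∃ x, f = vecFun x := by
  refine ⟨fun i => f (Pi.single i 1), ?_⟩
  ext i
  simp [vecFun, Pi.single_apply]

theorem matFun_surj {M C : ℕ} (f : (Fin M → Fin C → ℝ) →ₗ[ℝ] ℝ) : ∃ x, f = matFun x := by
  refine ⟨fun j k => f (Pi.single j (Pi.single k 1)), ?_⟩
  ext j k
  simp only [matFun, LinearMap.comp_apply, LinearMap.single_apply, LinearMap.coe_mk,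
    AddHom.coe_mk]
  rw [Finset.sum_eq_single j, Finset.sum_eq_single k]
  · simp
  · intro b _ hb; simp [hb]
  · simp
  · intro b _ hb; simp [hb]
  · simp

/-- The dual norm of the collaborative norm `‖·‖_{b,a}` is the collaborative norm
`‖·‖_{b*,a*}` built from the dual norms. -/
theorem dual_of_collaborative_norm (N M C : ℕ) (hN : 0 < N) (hM : 0 < M) (hC : 0 < C)
    (nb : (Fin M → Fin C → ℝ) → ℝ)
    (hb_nonneg : ∀ x, 0 ≤ nb x)
    (hb_add : ∀ x y, nb (x + y) ≤ nb x + nb y)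
    (hb_smul : ∀ (c : ℝ) x, nb (c • x) = |c| * nb x)
    (hb_def : ∀ x, nb x = 0 → x = 0)
    (na : (Fin N → ℝ) → ℝ)
    (ha_nonneg : ∀ v, 0 ≤ na v)
    (ha_add : ∀ v w, na (v + w) ≤ na v + na w)
    (ha_smul : ∀ (c : ℝ) v, na (c • v) = |c| * na v)
    (ha_def : ∀ v, na v = 0 → v = 0)
    (habs : ∀ v : Fin N → ℝ, dualNormVec na (fun i => |v i|) = dualNormVec na v)
    (A : Fin N → Fin M → Fin C → ℝ) :
    sSup {r : ℝ | ∃ B : Fin N → Fin M → Fin C → ℝ,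
        collabNorm (dualNormMat nb) (dualNormVec na) B ≤ 1 ∧ r = tinner A B}
      = collabNorm nb na A := by
  have hset : IsGreatest {r : ℝ | ∃ B : Fin N → Fin M → Fin C → ℝ,
        collabNorm (dualNormMat nb) (dualNormVec na) B ≤ 1 ∧ r = tinner A B}
        (collabNorm nb na A) := by
    have hub : ∀ B : Fin N → Fin M → Fin C → ℝ,
        collabNorm (dualNormMat nb) (dualNormVec na) B ≤ 1 →
        tinner A B ≤ collabNorm nb na A := by
      intro B hB
      have h1 : tinner A B ≤ ∑ i, dualNormMat nb (B i) * nb (A i) := by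
        refine Finset.sum_le_sum fun i _ => ?_
        have := dual_holder nb hb_nonneg hb_add hb_smul hb_def (matFun (B i)) (A i)
        calc ∑ j, ∑ k, A i j k * B i j k = matFun (B i) (A i) := by
              simp only [matFun, LinearMap.coe_mk, AddHom.coe_mk, mul_comm]
          _ ≤ nb (A i) * dualNormMat nb (B i) := this
          _ = _ := mul_comm _ _
      have h2 : ∑ i, dualNormMat nb (B i) * nb (A i)
          ≤ na (fun i => nb (A i)) * dualNormVec na (fun i => dualNormMat nb (B i)) :=
        dual_holder na ha_nonneg ha_add ha_smul ha_def
          (vecFun fun i => dualNormMat nb (B i)) (fun i => nb (A i))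
      have h3 := mul_le_mul_of_nonneg_left hB (ha_nonneg (fun i => nb (A i)))
      unfold collabNorm at h3 ⊢
      linarith
    refine ⟨?_, by rintro r ⟨B, hB, rfl⟩; exact hub B hB⟩
    -- norming vector
    obtain ⟨f, hf, hf'⟩ := (norm_facts na ha_nonneg ha_add ha_smul ha_def).2
      (fun i => nb (A i))
    obtain ⟨u, rfl⟩ := vecFun_surj f
    have hu : dualNormVec na (fun i => |u i|) ≤ 1 := by
      rw [habs]
      have hz : na 0 = 0 := by simpa using ha_smul 0 0
      refine csSup_le ⟨_, 0, by rw [hz]; exact zero_le_one, rfl⟩ ?_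
      rintro r ⟨y, hy, rfl⟩
      exact (hf' y).trans hy
    -- norming matrices
    have hG : ∀ i, ∃ G : Fin M → Fin C → ℝ, (∑ j, ∑ k, G j k * A i j k = nb (A i)) ∧
        (∀ y, ∑ j, ∑ k, G j k * y j k ≤ nb y) ∧
        ∃ y, nb y = 1 ∧ ∑ j, ∑ k, G j k * y j k = 1 := by
      intro i
      have key : ∀ x : Fin M → Fin C → ℝ, x ≠ 0 → ∃ G : Fin M → Fin C → ℝ,
          matFun G x = nb x ∧ (∀ y, matFun G y ≤ nb y) ∧
          ∃ y, nb y = 1 ∧ matFun G y = 1 := by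
        intro x hx
        obtain ⟨g, hg, hg'⟩ := (norm_facts nb hb_nonneg hb_add hb_smul hb_def).2 x
        obtain ⟨G, rfl⟩ := matFun_surj g
        have hpos : 0 < nb x := lt_of_le_of_ne (hb_nonneg x) fun h => hx (hb_def x h.symm)
        refine ⟨G, hg, hg', (nb x)⁻¹ • x, ?_, ?_⟩
        · rw [hb_smul, abs_of_pos (inv_pos.2 hpos), inv_mul_cancel₀ hpos.ne']
        · rw [map_smul, hg, smul_eq_mul, inv_mul_cancel₀ hpos.ne']
      by_cases hA : A i = 0
      · obtain ⟨G, -, h2, h3⟩ := key (fun _ _ => 1) (fun h => by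
          have := congrFun (congrFun h ⟨0, hM⟩) ⟨0, hC⟩
          simp at this)
        refine ⟨G, ?_, h2, h3⟩
        have hz : nb 0 = 0 := by simpa using hb_smul 0 0
        rw [hA, hz]; simp
      · exact key (A i) hA
    choose G hG1 hG2 hG3 using hG
    have hdual : ∀ i, dualNormMat nb (fun j k => |u i| * G i j k) = |u i| := by
      intro i
      have hs : ∀ y : Fin M → Fin C → ℝ, ∑ j, ∑ k, |u i| * G i j k * y j k
          = |u i| * ∑ j, ∑ k, G i j k * y j k := by
        intro y; simp only [Finset.mul_sum, mul_assoc]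
      apply IsGreatest.csSup_eq
      constructor
      · obtain ⟨y, hy, hy'⟩ := hG3 i
        exact ⟨y, hy.le, by rw [hs, hy', mul_one]⟩
      · rintro r ⟨y, hy, rfl⟩
        rw [hs]
        exact mul_le_of_le_one_right (abs_nonneg _) ((hG2 i y).trans hy)
    have hB : collabNorm (dualNormMat nb) (dualNormVec na)
        (fun i j k => |u i| * G i j k) ≤ 1 := by
      unfold collabNorm
      simp only [hdual]
      exact hu
    refine ⟨fun i j k => |u i| * G i j k, hB, le_antisymm ?_ (hub _ hB)⟩
    have ht : tinner A (fun i j k => |u i| * G i j k) = ∑ i, |u i| * nb (A i) := by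
      refine Finset.sum_congr rfl fun i _ => ?_
      rw [← hG1 i]
      simp only [Finset.mul_sum]
      exact Finset.sum_congr rfl fun j _ => Finset.sum_congr rfl fun k _ => by ring
    rw [ht]
    unfold collabNorm
    rw [← hf]
    change ∑ i, u i * nb (A i) ≤ ∑ i, |u i| * nb (A i)
    exact Finset.sum_le_sum fun i _ =>
      mul_le_mul_of_nonneg_right (le_abs_self _) (hb_nonneg _)
  exact hset.csSup_eq
end

section
/- Let N, M, C be positive natural numbers. Let ‖·‖_b be a norm on the space of real M×C matrices and ‖·‖_a a norm on ℝ^N, with dual norms ‖·‖_{b*} and ‖·‖_{a*}, and assume ‖·‖_{a*} is absolute, i.e. ‖v‖_{a*} = ‖|v|‖_{a*} for every v ∈ ℝ^N. Then the Hölder inequality |⟨A,B⟩| ≤ ‖A‖_{b,a} · ‖B‖_{b*,a*} holds for all tensors A, B ∈ ℝ^{N×M×C}. -/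
/-- A linear functional is bounded on the unit ball of any norm on a finite-dimensional space. -/
theorem exists_bound_of_norm_axioms {E : Type*} [AddCommGroup E] [Module ℝ E]
    [FiniteDimensional ℝ E] (n : E → ℝ) (h0 : ∀ x, 0 ≤ n x)
    (hadd : ∀ x y, n (x + y) ≤ n x + n y) (hsmul : ∀ (c : ℝ) x, n (c • x) = |c| * n x)
    (hdef : ∀ x, n x = 0 → x = 0) (f : E →ₗ[ℝ] ℝ) :
    ∃ K : ℝ, 0 ≤ K ∧ ∀ x, f x ≤ K * n x := by
  letI : Norm E := ⟨n⟩
  have core : NormedSpace.Core ℝ E :=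
    { norm_nonneg := h0
      norm_smul := hsmul
      norm_triangle := hadd
      norm_eq_zero_iff := fun x => ⟨hdef x, fun h => by
        have h2 : n 0 = 0 := by simpa using hsmul 0 0
        rw [h]
        exact h2⟩ }
  letI : NormedAddCommGroup E := NormedAddCommGroup.ofCore core
  letI : NormedSpace ℝ E := NormedSpace.ofCore core
  refine ⟨‖LinearMap.toContinuousLinearMap f‖, norm_nonneg _, fun x => ?_⟩
  exact (le_abs_self _).trans ((LinearMap.toContinuousLinearMap f).le_opNorm x)

/-- Generic duality inequality. -/
theorem le_sSup_mul_of_norm_axioms {E : Type*} [AddCommGroup E] [Module ℝ E]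
    [FiniteDimensional ℝ E] (n : E → ℝ) (h0 : ∀ x, 0 ≤ n x)
    (hadd : ∀ x y, n (x + y) ≤ n x + n y) (hsmul : ∀ (c : ℝ) x, n (c • x) = |c| * n x)
    (hdef : ∀ x, n x = 0 → x = 0) (f : E →ₗ[ℝ] ℝ) (x : E) :
    |f x| ≤ n x * sSup {r : ℝ | ∃ y : E, n y ≤ 1 ∧ r = f y} := by
  obtain ⟨K, hK, hf⟩ := exists_bound_of_norm_axioms n h0 hadd hsmul hdef f
  have hbdd : BddAbove {r : ℝ | ∃ y : E, n y ≤ 1 ∧ r = f y} := by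
    refine ⟨K, ?_⟩
    rintro r ⟨y, hy, rfl⟩
    exact (hf y).trans (mul_le_of_le_one_right hK hy)
  have key : ∀ x, f x ≤ n x * sSup {r : ℝ | ∃ y : E, n y ≤ 1 ∧ r = f y} := by
    intro x
    rcases (h0 x).eq_or_lt with h | h
    · have hx := hdef x h.symm
      rw [← h, hx]
      simp
    · have h1 : (n x)⁻¹ * f x ≤ sSup {r : ℝ | ∃ y : E, n y ≤ 1 ∧ r = f y} := by
        refine le_csSup hbdd ⟨(n x)⁻¹ • x, ?_, by simp⟩
        rw [hsmul, abs_of_pos (inv_pos.2 h), inv_mul_cancel₀ h.ne']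
      calc f x = n x * ((n x)⁻¹ * f x) := by field_simp
        _ ≤ _ := mul_le_mul_of_nonneg_left h1 h.le
  refine abs_le'.2 ⟨key x, ?_⟩
  have h := key (-x)
  have hn : n (-x) = n x := by simpa using hsmul (-1) x
  rwa [hn, map_neg] at h

/-- Hölder inequality for collaborative norms:
`|⟨A,B⟩| ≤ ‖A‖_{b,a} · ‖B‖_{b*,a*}`. -/
theorem holder_collaborative_norm (N M C : ℕ) (hN : 0 < N) (hM : 0 < M) (hC : 0 < C)
    (nb : (Fin M → Fin C → ℝ) → ℝ)
    (hb_nonneg : ∀ x, 0 ≤ nb x)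
    (hb_add : ∀ x y, nb (x + y) ≤ nb x + nb y)
    (hb_smul : ∀ (c : ℝ) x, nb (c • x) = |c| * nb x)
    (hb_def : ∀ x, nb x = 0 → x = 0)
    (na : (Fin N → ℝ) → ℝ)
    (ha_nonneg : ∀ v, 0 ≤ na v)
    (ha_add : ∀ v w, na (v + w) ≤ na v + na w)
    (ha_smul : ∀ (c : ℝ) v, na (c • v) = |c| * na v)
    (ha_def : ∀ v, na v = 0 → v = 0)
    (habs : ∀ v : Fin N → ℝ, dualNormVec na (fun i => |v i|) = dualNormVec na v)
    (A B : Fin N → Fin M → Fin C → ℝ) :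
    |tinner A B| ≤ collabNorm nb na A * collabNorm (dualNormMat nb) (dualNormVec na) B := by
  have hmat : ∀ i, |∑ j, ∑ k, A i j k * B i j k| ≤ nb (A i) * dualNormMat nb (B i) := by
    intro i
    let f : (Fin M → Fin C → ℝ) →ₗ[ℝ] ℝ :=
      { toFun := fun y => ∑ j, ∑ k, B i j k * y j k
        map_add' := fun x y => by simp [mul_add, Finset.sum_add_distrib]
        map_smul' := fun c x => by simp [Finset.mul_sum, mul_left_comm] }
    have h := le_sSup_mul_of_norm_axioms nb hb_nonneg hb_add hb_smul hb_def f (A i)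
    have he : f (A i) = ∑ j, ∑ k, A i j k * B i j k := by
      simp [f, mul_comm]
    rw [he] at h
    exact h
  let g : (Fin N → ℝ) →ₗ[ℝ] ℝ :=
    { toFun := fun y => ∑ i, dualNormMat nb (B i) * y i
      map_add' := fun x y => by simp [mul_add, Finset.sum_add_distrib]
      map_smul' := fun c x => by simp [Finset.mul_sum, mul_left_comm] }
  have hg := le_sSup_mul_of_norm_axioms na ha_nonneg ha_add ha_smul ha_def g (fun i => nb (A i))
  calc |tinner A B| ≤ ∑ i, |∑ j, ∑ k, A i j k * B i j k| := Finset.abs_sum_le_sum_abs _ _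
    _ ≤ ∑ i, nb (A i) * dualNormMat nb (B i) := Finset.sum_le_sum fun i _ => hmat i
    _ = g (fun i => nb (A i)) := by simp [g, mul_comm]
    _ ≤ _ := (le_abs_self _).trans hg
end

section
/- Let N, M, C be positive natural numbers. Let ‖·‖_b be a norm on the space of real M×C matrices and ‖·‖_a a norm on ℝ^N, with dual norms ‖·‖_{b*} and ‖·‖_{a*}, and assume ‖·‖_{a*} is absolute, i.e. ‖v‖_{a*} = ‖|v|‖_{a*} for every v ∈ ℝ^N. Then for every tensor A ∈ ℝ^{N×M×C}, the (convex) subdifferential of the collaborative norm ‖·‖_{b,a} at A equals the set of all tensors B ∈ ℝ^{N×M×C} such that ‖B‖_{b*,a*} ≤ 1 and ⟨B,A⟩ = ‖A‖_{b,a}. That is, B satisfies ‖X‖_{b,a} ≥ ‖A‖_{b,a} + ⟨B, X − A⟩ for all X if and only if ‖B‖_{b*,a*} ≤ 1 and ⟨B,A⟩ = ‖A‖_{b,a}. -/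
theorem exists_dual_maximizer {E : Type} [AddCommGroup E] [Module ℝ E] [FiniteDimensional ℝ E]
    [Nontrivial E] (p : E → ℝ) (h0 : ∀ x, 0 ≤ p x) (hadd : ∀ x y, p (x + y) ≤ p x + p y)
    (hsmul : ∀ (c : ℝ) x, p (c • x) = |c| * p x) (hdef : ∀ x, p x = 0 → x = 0)
    (f : E →ₗ[ℝ] ℝ) : ∃ w, p w = 1 ∧ 0 ≤ f w ∧ ∀ y, f y ≤ f w * p y := by
  let : Norm E := ⟨p⟩
  have core : NormedSpace.Core ℝ E :=
    { norm_nonneg := h0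
      norm_smul := fun c x => hsmul c x
      norm_triangle := hadd
      norm_eq_zero_iff := fun x => ⟨hdef x, fun h => by
        have := hsmul 0 x
        rw [zero_smul, abs_zero, zero_mul] at this
        rw [h]
        exact this⟩ }
  let : NormedAddCommGroup E := NormedAddCommGroup.ofCore core
  let : NormedSpace ℝ E := NormedSpace.ofCore core
  have : ProperSpace E := FiniteDimensional.proper ℝ E
  have hc : Continuous f := f.continuous_of_finiteDimensional
  obtain ⟨w, hw, hmax⟩ := (isCompact_sphere (0 : E) 1).exists_isMaxOn
    (NormedSpace.sphere_nonempty.2 zero_le_one) hc.continuousOn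
  have hw1 : p w = 1 := by
    have : ‖w‖ = 1 := by simpa using hw
    exact this
  have key : ∀ z, p z = 1 → f z ≤ f w := fun z hz => hmax (by
    have : ‖z‖ = 1 := hz
    simpa using this)
  have hpos : 0 ≤ f w := by
    have h1 := key ((-1 : ℝ) • w) (by rw [hsmul, hw1]; simp)
    rw [map_smul, smul_eq_mul] at h1
    linarith
  refine ⟨w, hw1, hpos, fun y => ?_⟩
  rcases (h0 y).eq_or_lt with h | h
  · rw [hdef y h.symm, map_zero]
    exact mul_nonneg hpos (h0 _)
  · have h1 := key ((p y)⁻¹ • y) (by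
      rw [hsmul, abs_of_pos (inv_pos.2 h), inv_mul_cancel₀ h.ne'])
    rw [map_smul, smul_eq_mul, inv_mul_le_iff₀ h] at h1
    linarith

theorem exists_norming_functional {E : Type} [AddCommGroup E] [Module ℝ E]
    (p : E → ℝ) (h0 : ∀ x, 0 ≤ p x) (hadd : ∀ x y, p (x + y) ≤ p x + p y)
    (hsmul : ∀ (c : ℝ) x, p (c • x) = |c| * p x) (hdef : ∀ x, p x = 0 → x = 0)
    (x : E) : ∃ f : E →ₗ[ℝ] ℝ, f x = p x ∧ ∀ y, f y ≤ p y := by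
  let : Norm E := ⟨p⟩
  have core : NormedSpace.Core ℝ E :=
    { norm_nonneg := h0
      norm_smul := fun c x => hsmul c x
      norm_triangle := hadd
      norm_eq_zero_iff := fun x => ⟨hdef x, fun h => by
        have := hsmul 0 x
        rw [zero_smul, abs_zero, zero_mul] at this
        rw [h]
        exact this⟩ }
  let : NormedAddCommGroup E := NormedAddCommGroup.ofCore core
  let : NormedSpace ℝ E := NormedSpace.ofCore core
  obtain ⟨g, hg, hgx⟩ := exists_dual_vector'' ℝ x
  refine ⟨g.toLinearMap, hgx, fun y => ?_⟩
  have h1 : g y ≤ ‖g‖ * ‖y‖ := (le_abs_self _).trans (g.le_opNorm y)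
  have h2 : ‖g‖ * ‖y‖ ≤ 1 * ‖y‖ := mul_le_mul_of_nonneg_right hg (norm_nonneg _)
  rw [one_mul] at h2
  exact h1.trans h2

theorem sSup_dual {E : Type} (p : E → ℝ) (f : E → ℝ) (w : E) (hw : p w = 1) (h0 : 0 ≤ f w)
    (h : ∀ y, f y ≤ f w * p y) : sSup {r : ℝ | ∃ y, p y ≤ 1 ∧ r = f y} = f w := by
  apply IsGreatest.csSup_eq
  refine ⟨⟨w, hw.le, rfl⟩, ?_⟩
  rintro r ⟨y, hy, rfl⟩
  exact (h y).trans (mul_le_of_le_one_right h0 hy)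

theorem dualNormVec_spec {N : ℕ} (hN : 0 < N) (p : (Fin N → ℝ) → ℝ)
    (h0 : ∀ x, 0 ≤ p x) (hadd : ∀ x y, p (x + y) ≤ p x + p y)
    (hsmul : ∀ (c : ℝ) x, p (c • x) = |c| * p x) (hdef : ∀ x, p x = 0 → x = 0)
    (x : Fin N → ℝ) : ∃ w, p w = 1 ∧ ∑ i, x i * w i = dualNormVec p x ∧
      ∀ y, ∑ i, x i * y i ≤ dualNormVec p x * p y := by
  have : Nonempty (Fin N) := ⟨⟨0, hN⟩⟩
  let f : (Fin N → ℝ) →ₗ[ℝ] ℝ :=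
    { toFun := fun y => ∑ i, x i * y i
      map_add' := fun y z => by simp [mul_add, Finset.sum_add_distrib]
      map_smul' := fun c y => by simp [Finset.mul_sum, mul_left_comm] }
  obtain ⟨w, hw, hf, h⟩ := exists_dual_maximizer p h0 hadd hsmul hdef f
  have e : dualNormVec p x = f w := sSup_dual p f w hw hf h
  refine ⟨w, hw, e.symm, fun y => ?_⟩
  rw [e]
  exact h y

theorem dualNormMat_spec {M C : ℕ} (hM : 0 < M) (hC : 0 < C) (p : (Fin M → Fin C → ℝ) → ℝ)
    (h0 : ∀ x, 0 ≤ p x) (hadd : ∀ x y, p (x + y) ≤ p x + p y)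
    (hsmul : ∀ (c : ℝ) x, p (c • x) = |c| * p x) (hdef : ∀ x, p x = 0 → x = 0)
    (x : Fin M → Fin C → ℝ) : ∃ w, p w = 1 ∧ ∑ j, ∑ k, x j k * w j k = dualNormMat p x ∧
      0 ≤ dualNormMat p x ∧
      ∀ y, ∑ j, ∑ k, x j k * y j k ≤ dualNormMat p x * p y := by
  have : Nonempty (Fin M) := ⟨⟨0, hM⟩⟩
  have : Nonempty (Fin C) := ⟨⟨0, hC⟩⟩
  let f : (Fin M → Fin C → ℝ) →ₗ[ℝ] ℝ :=
    { toFun := fun y => ∑ j, ∑ k, x j k * y j k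
      map_add' := fun y z => by simp [mul_add, Finset.sum_add_distrib]
      map_smul' := fun c y => by simp [Finset.mul_sum, mul_left_comm] }
  obtain ⟨w, hw, hf, h⟩ := exists_dual_maximizer p h0 hadd hsmul hdef f
  have e : dualNormMat p x = f w := sSup_dual p f w hw hf h
  refine ⟨w, hw, e.symm, by rw [e]; exact hf, fun y => ?_⟩
  rw [e]
  exact h y

/-- If the dual norm is absolute, the norm of `|y|` is at most the norm of `y`. -/
theorem norm_abs_le {N : ℕ} (hN : 0 < N) (p : (Fin N → ℝ) → ℝ)
    (h0 : ∀ x, 0 ≤ p x) (hadd : ∀ x y, p (x + y) ≤ p x + p y)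
    (hsmul : ∀ (c : ℝ) x, p (c • x) = |c| * p x) (hdef : ∀ x, p x = 0 → x = 0)
    (habs : ∀ v : Fin N → ℝ, dualNormVec p (fun i => |v i|) = dualNormVec p v)
    (y : Fin N → ℝ) : p (fun i => |y i|) ≤ p y := by
  obtain ⟨f, hf, hle⟩ := exists_norming_functional p h0 hadd hsmul hdef (fun i => |y i|)
  let z : Fin N → ℝ := fun i => f (Pi.single i 1)
  have hz : ∀ v, f v = ∑ i, z i * v i := fun v => by
    rw [LinearMap.pi_apply_eq_sum_univ f v]
    refine Finset.sum_congr rfl fun i _ => ?_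
    rw [smul_eq_mul, mul_comm]
    congr 2
    ext j
    simp [Pi.single_apply, eq_comm]
  let s : Fin N → ℝ := fun i => if 0 ≤ y i then 1 else -1
  have hs : ∀ i, |s i| = 1 := fun i => by
    by_cases h : 0 ≤ y i <;> simp [s, h]
  have hsy : ∀ i, s i * y i = |y i| := fun i => by
    by_cases h : 0 ≤ y i
    · simp [s, h, abs_of_nonneg h]
    · simp [s, h, abs_of_neg (not_le.1 h)]
  have hdz : dualNormVec p z ≤ 1 := by
    obtain ⟨w, hw, e, -⟩ := dualNormVec_spec hN p h0 hadd hsmul hdef z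
    rw [← e, ← hz, ← hw]
    exact hle w
  have hd : dualNormVec p (fun i => z i * s i) = dualNormVec p z := by
    rw [← habs, ← habs z]
    congr 1
    ext i
    rw [abs_mul, hs, mul_one]
  obtain ⟨-, -, -, hb⟩ := dualNormVec_spec hN p h0 hadd hsmul hdef (fun i => z i * s i)
  have h1 := hb y
  rw [hd] at h1
  have h2 : ∑ i, z i * s i * y i = p (fun i => |y i|) := by
    rw [← hf, hz]
    exact Finset.sum_congr rfl fun i _ => by rw [mul_assoc, hsy]
  rw [h2] at h1
  exact h1.trans (mul_le_of_le_one_left (h0 y) hdz)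

/-- Characterization of the subdifferential of a collaborative norm:
`B ∈ ∂‖·‖_{b,a}(A)` iff `‖B‖_{b*,a*} ≤ 1` and `⟨B,A⟩ = ‖A‖_{b,a}`. -/
theorem subdifferential_collaborative_norm (N M C : ℕ) (hN : 0 < N) (hM : 0 < M) (hC : 0 < C)
    (nb : (Fin M → Fin C → ℝ) → ℝ)
    (hb_nonneg : ∀ x, 0 ≤ nb x)
    (hb_add : ∀ x y, nb (x + y) ≤ nb x + nb y)
    (hb_smul : ∀ (c : ℝ) x, nb (c • x) = |c| * nb x)
    (hb_def : ∀ x, nb x = 0 → x = 0)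
    (na : (Fin N → ℝ) → ℝ)
    (ha_nonneg : ∀ v, 0 ≤ na v)
    (ha_add : ∀ v w, na (v + w) ≤ na v + na w)
    (ha_smul : ∀ (c : ℝ) v, na (c • v) = |c| * na v)
    (ha_def : ∀ v, na v = 0 → v = 0)
    (habs : ∀ v : Fin N → ℝ, dualNormVec na (fun i => |v i|) = dualNormVec na v)
    (A B : Fin N → Fin M → Fin C → ℝ) :
    (∀ X : Fin N → Fin M → Fin C → ℝ,
        collabNorm nb na A + tinner B (X - A) ≤ collabNorm nb na X)
      ↔ (collabNorm (dualNormMat nb) (dualNormVec na) B ≤ 1 ∧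
          tinner B A = collabNorm nb na A) := by
  have hsub : ∀ X Y : Fin N → Fin M → Fin C → ℝ, tinner B (X - Y) = tinner B X - tinner B Y :=
    fun X Y => by simp [tinner, mul_sub, Finset.sum_sub_distrib]
  have hts : ∀ (c : ℝ) (X : Fin N → Fin M → Fin C → ℝ), tinner B (c • X) = c * tinner B X :=
    fun c X => by simp [tinner, Finset.mul_sum, mul_left_comm]
  have hFs : ∀ (c : ℝ) (X : Fin N → Fin M → Fin C → ℝ),
      collabNorm nb na (c • X) = |c| * collabNorm nb na X := fun c X => by
    have : (fun i => nb ((c • X) i)) = |c| • fun i => nb (X i) := by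
      ext i
      simp [hb_smul]
    unfold collabNorm
    rw [this, ha_smul, abs_abs]
  choose w hw1 hwe hwn hwl using
    fun i => dualNormMat_spec hM hC nb hb_nonneg hb_add hb_smul hb_def (B i)
  obtain ⟨u, hu1, hue, hul⟩ := dualNormVec_spec hN na ha_nonneg ha_add ha_smul ha_def
    (fun i => dualNormMat nb (B i))
  constructor
  · intro h
    have heq : tinner B A = collabNorm nb na A := by
      have h1 := h ((2 : ℝ) • A)
      have h2 := h ((0 : ℝ) • A)
      rw [hsub, hts, hFs] at h1 h2
      norm_num at h1 h2
      linarith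
    refine ⟨?_, heq⟩
    have hX : ∀ X, tinner B X ≤ collabNorm nb na X := fun X => by
      have := h X
      rw [hsub] at this
      linarith
    unfold collabNorm
    rw [← hue]
    have h1 := hX (fun i => |u i| • w i)
    have h2 : collabNorm nb na (fun i => |u i| • w i) = na (fun i => |u i|) := by
      simp [collabNorm, hb_smul, hw1]
    have h3 : tinner B (fun i => |u i| • w i) = ∑ i, dualNormMat nb (B i) * |u i| := by
      unfold tinner
      refine Finset.sum_congr rfl fun i _ => ?_
      rw [← hwe]
      rw [mul_comm]
      simp [Finset.mul_sum, mul_left_comm]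
    rw [h2, h3] at h1
    have h4 := norm_abs_le hN na ha_nonneg ha_add ha_smul ha_def habs u
    have h5 : ∑ i, dualNormMat nb (B i) * u i ≤ ∑ i, dualNormMat nb (B i) * |u i| :=
      Finset.sum_le_sum fun i _ => mul_le_mul_of_nonneg_left (le_abs_self _) (hwn i)
    linarith
  · rintro ⟨h1, h2⟩ X
    have h3 : tinner B X ≤ ∑ i, dualNormMat nb (B i) * nb (X i) :=
      Finset.sum_le_sum fun i _ => hwl i (X i)
    have h4 := hul (fun i => nb (X i))
    have h5 : dualNormVec na (fun i => dualNormMat nb (B i)) * na (fun i => nb (X i))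
        ≤ na (fun i => nb (X i)) := mul_le_of_le_one_left (ha_nonneg _) h1
    rw [hsub]
    change _ ≤ na (fun i => nb (X i))
    linarith
end

section
/- Let N, M, C be positive natural numbers and let p, q, r ∈ (1,∞) with Hölder conjugate exponents p*, q*, r* (i.e. 1/p + 1/p* = 1, 1/q + 1/q* = 1, 1/r + 1/r* = 1). Then for every tensor A ∈ ℝ^{N×M×C}, the supremum of the Frobenius inner product ⟨A,B⟩ over all tensors B ∈ ℝ^{N×M×C} with ‖B‖_{p*,q*,r*} ≤ 1 equals ‖A‖_{p,q,r}. In other words, the ℓ^{p*,q*,r*} norm is the dual norm of the ℓ^{p,q,r} norm. -/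
/-- The `ℓ^{p,q,r}` norm of a third-order tensor: `ℓ^p` along channels, then `ℓ^q`
along derivatives, then `ℓ^r` along pixels. -/
noncomputable def lpqrNorm {N M C : ℕ} (p q r : ℝ) (A : Fin N → Fin M → Fin C → ℝ) : ℝ :=
  (∑ i, (∑ j, (∑ k, |A i j k| ^ p) ^ (q / p)) ^ (r / q)) ^ (1 / r)

noncomputable def LL {ι : Type*} [Fintype ι] (p : ℝ) (f : ι → ℝ) : ℝ :=
  (∑ i, |f i| ^ p) ^ (1 / p)

lemma LL_nonneg {ι : Type*} [Fintype ι] (p : ℝ) (f : ι → ℝ) : 0 ≤ LL p f := by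
  unfold LL; positivity

lemma LL_mono {ι : Type*} [Fintype ι] {p : ℝ} (hp : 0 < p) {f g : ι → ℝ}
    (h : ∀ i, |f i| ≤ |g i|) : LL p f ≤ LL p g := by
  unfold LL
  apply Real.rpow_le_rpow (by positivity) _ (by positivity)
  exact Finset.sum_le_sum fun i _ => Real.rpow_le_rpow (abs_nonneg _) (h i) hp.le

lemma LL_smul {ι : Type*} [Fintype ι] {p : ℝ} (hp : 0 < p) (c : ℝ) (hc : 0 ≤ c) (f : ι → ℝ) :
    LL p (fun i => c * f i) = c * LL p f := by
  unfold LL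
  have : ∀ i, |c * f i| ^ p = c ^ p * |f i| ^ p := fun i => by
    rw [abs_mul, abs_of_nonneg hc, Real.mul_rpow hc (abs_nonneg _)]
  simp only [this]
  rw [← Finset.mul_sum, Real.mul_rpow (by positivity) (by positivity), ← Real.rpow_mul hc,
    mul_one_div_cancel hp.ne', Real.rpow_one]

lemma LL_attain {ι : Type*} [Fintype ι] {p p' : ℝ} (h : p.HolderConjugate p') (f : ι → ℝ) :
    ∃ g : ι → ℝ, (∀ i, 0 ≤ g i) ∧ LL p' g ≤ 1 ∧ ∑ i, |f i| * g i = LL p f := by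
  obtain ⟨g, hg, hs⟩ := (NNReal.isGreatest_Lp Finset.univ (fun i => Real.nnabs (f i)) h).1
  have hg1 : ∑ i, g i ^ p' ≤ 1 := hg
  refine ⟨fun i => g i, fun i => (g i).2, ?_, ?_⟩
  · unfold LL
    apply Real.rpow_le_one (by positivity) _ (one_div_nonneg.2 h.symm.nonneg)
    simp only [NNReal.abs_eq]
    exact_mod_cast hg1
  · have := congrArg NNReal.toReal hs
    simpa [LL] using this

lemma LL_holder {ι : Type*} [Fintype ι] {p p' : ℝ} (h : p.HolderConjugate p') (f g : ι → ℝ) :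
    ∑ i, f i * g i ≤ LL p f * LL p' g :=
  Real.inner_le_Lp_mul_Lq Finset.univ f g h

lemma lpqr_eq {N M C : ℕ} {p q r : ℝ} (A : Fin N → Fin M → Fin C → ℝ) :
    lpqrNorm p q r A = LL r (fun i => LL q (fun j => LL p (A i j))) := by
  unfold lpqrNorm
  unfold LL
  congr 1
  refine Finset.sum_congr rfl fun i _ => ?_
  rw [abs_of_nonneg (by positivity), ← Real.rpow_mul (by positivity), one_div_mul_eq_div]
  congr 1
  refine Finset.sum_congr rfl fun j _ => ?_
  rw [abs_of_nonneg (by positivity), ← Real.rpow_mul (by positivity), one_div_mul_eq_div]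

/-- The `ℓ^{p*,q*,r*}` norm is the dual norm of the `ℓ^{p,q,r}` norm, where
`p*`, `q*`, `r*` are the Hölder conjugate exponents of `p`, `q`, `r`. -/
theorem dual_of_lpqr_norm (N M C : ℕ) (hN : 0 < N) (hM : 0 < M) (hC : 0 < C)
    (p q r pstar qstar rstar : ℝ)
    (hp : 1 < p) (hq : 1 < q) (hr : 1 < r)
    (hp' : 1 < pstar) (hq' : 1 < qstar) (hr' : 1 < rstar)
    (hpc : 1 / p + 1 / pstar = 1)
    (hqc : 1 / q + 1 / qstar = 1)
    (hrc : 1 / r + 1 / rstar = 1)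
    (A : Fin N → Fin M → Fin C → ℝ) :
    sSup {s : ℝ | ∃ B : Fin N → Fin M → Fin C → ℝ,
        lpqrNorm pstar qstar rstar B ≤ 1 ∧ s = tinner A B}
      = lpqrNorm p q r A := by
  have Hp : p.HolderConjugate pstar := Real.holderConjugate_iff.2 ⟨hp, by simpa using hpc⟩
  have Hq : q.HolderConjugate qstar := Real.holderConjugate_iff.2 ⟨hq, by simpa using hqc⟩
  have Hr : r.HolderConjugate rstar := Real.holderConjugate_iff.2 ⟨hr, by simpa using hrc⟩
  have p0 : 0 < pstar := by linarith
  have q0 : 0 < qstar := by linarith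
  have r0 : 0 < rstar := by linarith
  apply IsGreatest.csSup_eq
  simp only [lpqr_eq]
  constructor
  · choose c hc0 hc1 hc using fun i j => LL_attain Hp (A i j)
    choose b hb0 hb1 hb using fun i => LL_attain Hq (fun j => LL p (A i j))
    obtain ⟨a, ha0, ha1, ha⟩ := LL_attain Hr (fun i => LL q (fun j => LL p (A i j)))
    simp only [abs_of_nonneg (LL_nonneg _ _)] at hb ha
    refine ⟨fun i j k => a i * (b i j * (SignType.sign (A i j k) * c i j k)), ?_, ?_⟩
    · simp only [LL_smul p0 _ (ha0 _), LL_smul p0 _ (hb0 _ _), LL_smul q0 _ (ha0 _)]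
      refine le_trans (LL_mono r0 fun i => ?_) ha1
      rw [abs_of_nonneg (mul_nonneg (ha0 i) (LL_nonneg _ _)), abs_of_nonneg (ha0 i)]
      refine mul_le_of_le_one_right (ha0 i) (le_trans (LL_mono q0 fun j => ?_) (hb1 i))
      rw [abs_of_nonneg (mul_nonneg (hb0 i j) (LL_nonneg _ _)), abs_of_nonneg (hb0 i j)]
      refine mul_le_of_le_one_right (hb0 i j) (le_trans (LL_mono p0 fun k => ?_) (hc1 i j))
      rw [abs_mul]
      refine mul_le_of_le_one_left (abs_nonneg _) ?_
      rcases lt_trichotomy (A i j k) 0 with h | h | h <;> simp [h]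
    · rw [← ha]
      unfold tinner
      refine Finset.sum_congr rfl fun i _ => ?_
      rw [← hb i, Finset.sum_mul]
      refine Finset.sum_congr rfl fun j _ => ?_
      rw [← hc i j, Finset.sum_mul, Finset.sum_mul]
      refine Finset.sum_congr rfl fun k _ => ?_
      rw [← self_mul_sign]
      ring
  · rintro s ⟨B, hB, rfl⟩
    refine le_trans ?_ (mul_le_of_le_one_right (LL_nonneg _ _) hB)
    refine le_trans (Finset.sum_le_sum fun i _ => ?_) (LL_holder Hr _ _)
    refine le_trans (Finset.sum_le_sum fun j _ => ?_) (LL_holder Hq _ _)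
    exact LL_holder Hp _ _
end

section
/- Let N, M, C be positive natural numbers and τ > 0. For a tensor A ∈ ℝ^{N×M×C}, the tensor Â defined by Â_{i,j,k} := max(‖A_{i,j,:}‖₂ − τ, 0) · A_{i,j,k}/‖A_{i,j,:}‖₂ when ‖A_{i,j,:}‖₂ ≠ 0, and Â_{i,j,k} := 0 when ‖A_{i,j,:}‖₂ = 0, is the unique minimizer over Y ∈ ℝ^{N×M×C} of ½‖Y − A‖₂² + τ ‖Y‖_{2,1,1}, where ‖Y‖_{2,1,1} := Σ_{i,j} ‖Y_{i,j,:}‖₂ and ‖Y_{i,j,:}‖₂ := sqrt(Σ_k Y_{i,j,k}²). That is, the proximity operator of the ℓ^{2,1,1} norm is the generalized (group) shrinkage over the third dimension. -/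
/-- Euclidean norm of the fiber `Y_{i,j,:}` of a tensor. -/
noncomputable def fiberNorm {N M C : ℕ} (Y : Fin N → Fin M → Fin C → ℝ)
    (i : Fin N) (j : Fin M) : ℝ :=
  Real.sqrt (∑ k, (Y i j k) ^ 2)

/-- The objective `½‖Y − A‖₂² + τ‖Y‖_{2,1,1}` for the prox of the `ℓ^{2,1,1}` norm. -/
noncomputable def objL211 {N M C : ℕ} (τ : ℝ) (A Y : Fin N → Fin M → Fin C → ℝ) : ℝ :=
  (1/2) * ∑ i, ∑ j, ∑ k, (Y i j k - A i j k) ^ 2 + τ * ∑ i, ∑ j, fiberNorm Y i j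

/-- Strong convexity estimate on a single fiber. -/
lemma fiber_ineq_aux {C : ℕ} (τ : ℝ) (a y p : Fin C → ℝ) (s : ℝ) (hs : 0 ≤ s) (hs1 : s ≤ 1)
    (hp : ∀ k, p k = s * a k)
    (h1 : (1 - s) * Real.sqrt (∑ k, a k ^ 2) ≤ τ)
    (h2 : s * (τ - (1 - s) * Real.sqrt (∑ k, a k ^ 2)) = 0) :
    (1/2) * ∑ k, (p k - a k) ^ 2 + τ * Real.sqrt (∑ k, p k ^ 2) + (1/2) * ∑ k, (y k - p k) ^ 2
      ≤ (1/2) * ∑ k, (y k - a k) ^ 2 + τ * Real.sqrt (∑ k, y k ^ 2) := by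
  have hcs := Real.sum_mul_le_sqrt_mul_sqrt Finset.univ a y
  have hpn : Real.sqrt (∑ k, p k ^ 2) = s * Real.sqrt (∑ k, a k ^ 2) := by
    simp only [hp, mul_pow, ← Finset.mul_sum]
    rw [Real.sqrt_mul (sq_nonneg s), Real.sqrt_sq hs]
  have hn2 : Real.sqrt (∑ k, a k ^ 2) ^ 2 = ∑ k, a k ^ 2 :=
    Real.sq_sqrt (Finset.sum_nonneg fun k _ => sq_nonneg _)
  have hid : (1/2) * ∑ k, (y k - a k) ^ 2 - (1/2) * ∑ k, (p k - a k) ^ 2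
      - (1/2) * ∑ k, (y k - p k) ^ 2
      = (1 - s) * s * (∑ k, a k ^ 2) - (1 - s) * ∑ k, a k * y k := by
    simp only [hp, Finset.mul_sum, ← Finset.sum_sub_distrib]
    exact Finset.sum_congr rfl fun k _ => by ring
  have hy := Real.sqrt_nonneg (∑ k, y k ^ 2)
  rw [hpn]
  rw [← hn2] at hid
  generalize Real.sqrt (∑ k, a k ^ 2) = n at *
  generalize Real.sqrt (∑ k, y k ^ 2) = m at *
  have e1 := mul_le_mul_of_nonneg_left hcs (sub_nonneg.2 hs1)
  have e2 := mul_le_mul_of_nonneg_right h1 hy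
  have e3 : n * (s * (τ - (1 - s) * n)) = 0 := by rw [h2, mul_zero]
  nlinarith

/-- Strong convexity estimate for the whole objective. -/
lemma obj_ineq_aux {N M C : ℕ} (τ : ℝ) (hτ : 0 < τ)
    (A Ahat : Fin N → Fin M → Fin C → ℝ)
    (hAhat : ∀ i j k, Ahat i j k =
        if fiberNorm A i j = 0 then 0
        else max (fiberNorm A i j - τ) 0 * (A i j k / fiberNorm A i j))
    (Y : Fin N → Fin M → Fin C → ℝ) :
    objL211 τ A Ahat + (1/2) * ∑ i, ∑ j, ∑ k, (Y i j k - Ahat i j k) ^ 2 ≤ objL211 τ A Y := by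
  unfold objL211
  simp only [Finset.mul_sum (Finset.univ : Finset (Fin N)),
    Finset.mul_sum (Finset.univ : Finset (Fin M)), ← Finset.sum_add_distrib]
  refine Finset.sum_le_sum fun i _ => Finset.sum_le_sum fun j _ => ?_
  have hn : 0 ≤ fiberNorm A i j := Real.sqrt_nonneg _
  have key : ∃ s : ℝ, 0 ≤ s ∧ s ≤ 1 ∧ (∀ k, Ahat i j k = s * A i j k) ∧
      (1 - s) * fiberNorm A i j ≤ τ ∧ s * (τ - (1 - s) * fiberNorm A i j) = 0 := by
    rcases le_or_gt (fiberNorm A i j) τ with h | h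
    · refine ⟨0, le_rfl, zero_le_one, fun k => ?_, by linarith, by ring⟩
      rw [hAhat, max_eq_right (by linarith)]
      simp
    · have hpos : 0 < fiberNorm A i j := hτ.trans h
      have hc : (1 - (fiberNorm A i j - τ) / fiberNorm A i j) * fiberNorm A i j = τ := by
        field_simp
        ring
      refine ⟨(fiberNorm A i j - τ) / fiberNorm A i j, div_nonneg (by linarith) hn,
        (div_le_one hpos).2 (by linarith), fun k => ?_, hc.le, by rw [hc]; ring⟩
      rw [hAhat, if_neg hpos.ne', max_eq_left (by linarith)]
      ring
  obtain ⟨s, h0, h1, hp, h2, h3⟩ := key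
  exact fiber_ineq_aux τ (A i j) (Y i j) (Ahat i j) s h0 h1 hp h2 h3

/-- The proximity operator of the `ℓ^{2,1,1}` norm is the generalized (group)
shrinkage over the third dimension. -/
theorem prox_l211_group_shrinkage (N M C : ℕ) (hN : 0 < N) (hM : 0 < M) (hC : 0 < C)
    (τ : ℝ) (hτ : 0 < τ)
    (A : Fin N → Fin M → Fin C → ℝ)
    (Ahat : Fin N → Fin M → Fin C → ℝ)
    (hAhat : ∀ i j k, Ahat i j k =
        if fiberNorm A i j = 0 then 0
        else max (fiberNorm A i j - τ) 0 * (A i j k / fiberNorm A i j)) :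
    (∀ Y : Fin N → Fin M → Fin C → ℝ, objL211 τ A Ahat ≤ objL211 τ A Y) ∧
    (∀ Y : Fin N → Fin M → Fin C → ℝ, objL211 τ A Y ≤ objL211 τ A Ahat → Y = Ahat) := by
  refine ⟨fun Y => ?_, fun Y hY => ?_⟩
  · have h := obj_ineq_aux τ hτ A Ahat hAhat Y
    have h' : 0 ≤ ∑ i, ∑ j, ∑ k, (Y i j k - Ahat i j k) ^ 2 := by positivity
    linarith
  · have h := obj_ineq_aux τ hτ A Ahat hAhat Y
    have h' : ∑ i, ∑ j, ∑ k, (Y i j k - Ahat i j k) ^ 2 ≤ 0 := by linarith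
    funext i j k
    have h1 : (Y i j k - Ahat i j k) ^ 2 ≤ ∑ k, (Y i j k - Ahat i j k) ^ 2 :=
      Finset.single_le_sum (f := fun k => (Y i j k - Ahat i j k) ^ 2)
        (fun _ _ => by positivity) (Finset.mem_univ k)
    have h2 : ∑ k, (Y i j k - Ahat i j k) ^ 2 ≤ ∑ j, ∑ k, (Y i j k - Ahat i j k) ^ 2 :=
      Finset.single_le_sum (f := fun j => ∑ k, (Y i j k - Ahat i j k) ^ 2)
        (fun _ _ => by positivity) (Finset.mem_univ j)
    have h3 : ∑ j, ∑ k, (Y i j k - Ahat i j k) ^ 2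
        ≤ ∑ i, ∑ j, ∑ k, (Y i j k - Ahat i j k) ^ 2 :=
      Finset.single_le_sum (f := fun i => ∑ j, ∑ k, (Y i j k - Ahat i j k) ^ 2)
        (fun _ _ => by positivity) (Finset.mem_univ i)
    have h4 : (Y i j k - Ahat i j k) ^ 2 = 0 :=
      le_antisymm (by linarith) (sq_nonneg _)
    exact sub_eq_zero.1 (pow_eq_zero_iff two_ne_zero |>.1 h4)
end

section
/- Let N, M, C be positive natural numbers and τ > 0. For a tensor A ∈ ℝ^{N×M×C}, define for each pair (i,j) the vector P^{(i,j)} ∈ ℝ^C as the Euclidean projection of the vector (1/τ)|A_{i,j,:}| (componentwise absolute values) onto the closed unit ℓ¹ ball {w ∈ ℝ^C : Σ_k |w_k| ≤ 1}. Then the tensor Â defined by Â_{i,j,k} := A_{i,j,k} − τ · sign(A_{i,j,k}) · P^{(i,j)}_k is the unique minimizer over Y ∈ ℝ^{N×M×C} of ½‖Y − A‖₂² + τ ‖Y‖_{∞,1,1}, where ‖Y‖_{∞,1,1} := Σ_{i,j} max_k |Y_{i,j,k}|. -/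
/-- The objective `½‖Y − A‖₂² + τ‖Y‖_{∞,1,1}`, where
`‖Y‖_{∞,1,1} = Σ_{i,j} max_k |Y_{i,j,k}|`. -/
noncomputable def objLinf11 {N M C : ℕ} (τ : ℝ) (A Y : Fin N → Fin M → Fin C → ℝ) : ℝ :=
  (1/2) * ∑ i, ∑ j, ∑ k, (Y i j k - A i j k) ^ 2 + τ * ∑ i, ∑ j, ⨆ k, |Y i j k|

theorem proj_vi {C : ℕ} (p b : Fin C → ℝ) (hp : ∑ k, |p k| ≤ 1)
    (hmin : ∀ w : Fin C → ℝ, ∑ k, |w k| ≤ 1 → ∑ k, (p k - b k) ^ 2 ≤ ∑ k, (w k - b k) ^ 2)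
    (w : Fin C → ℝ) (hw : ∑ k, |w k| ≤ 1) : ∑ k, (b k - p k) * (w k - p k) ≤ 0 := by
  by_contra hX
  push Not at hX
  set X := ∑ k, (b k - p k) * (w k - p k) with hXdef
  set D := ∑ k, (w k - p k) ^ 2 with hD
  have hD0 : 0 ≤ D := Finset.sum_nonneg fun k _ => sq_nonneg _
  have key : ∀ t : ℝ, 0 < t → t ≤ 1 → 2 * X ≤ t * D := by
    intro t ht ht1
    have h1 : ∑ k, |p k + t * (w k - p k)| ≤ 1 := by
      calc ∑ k, |p k + t * (w k - p k)| ≤ ∑ k, ((1 - t) * |p k| + t * |w k|) := by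
            refine Finset.sum_le_sum fun k _ => ?_
            have : p k + t * (w k - p k) = (1 - t) * p k + t * w k := by ring
            rw [this]
            refine (abs_add_le _ _).trans ?_
            rw [abs_mul, abs_mul, abs_of_pos ht, abs_of_nonneg (by linarith : 0 ≤ 1 - t)]
        _ = (1 - t) * ∑ k, |p k| + t * ∑ k, |w k| := by
            rw [Finset.sum_add_distrib, Finset.mul_sum, Finset.mul_sum]
        _ ≤ 1 := by nlinarith
    have h2 := hmin _ h1
    have h3 : ∑ k, (p k + t * (w k - p k) - b k) ^ 2
        = ∑ k, (p k - b k) ^ 2 - 2 * t * X + t ^ 2 * D := by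
      rw [hXdef, hD, Finset.mul_sum, Finset.mul_sum, ← Finset.sum_sub_distrib,
        ← Finset.sum_add_distrib]
      exact Finset.sum_congr rfl fun k _ => by ring
    rw [h3] at h2
    have h4 : t * (2 * X) ≤ t * (t * D) := by linarith
    exact le_of_mul_le_mul_left h4 ht
  have h := key (X / (X + D)) (by positivity) (by rw [div_le_one (by positivity)]; linarith)
  rw [div_mul_eq_mul_div, le_div_iff₀ (by positivity)] at h
  nlinarith [mul_pos hX hX, mul_nonneg hX.le hD0]

theorem abs_rsign_le (x : ℝ) : |Real.sign x| ≤ 1 := by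
  rcases Real.sign_apply_eq x with h | h | h <;> simp [h]

theorem fiber {C : ℕ} (hC : 0 < C) (τ : ℝ) (hτ : 0 < τ) (a p u y : Fin C → ℝ)
    (hp : ∑ k, |p k| ≤ 1)
    (hmin : ∀ w : Fin C → ℝ, ∑ k, |w k| ≤ 1 →
      ∑ k, (p k - (1/τ) * |a k|) ^ 2 ≤ ∑ k, (w k - (1/τ) * |a k|) ^ 2)
    (hu : ∀ k, u k = a k - τ * Real.sign (a k) * p k) :
    (1/2) * ∑ k, (u k - a k) ^ 2 + τ * (⨆ k, |u k|) + (1/2) * ∑ k, (y k - u k) ^ 2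
      ≤ (1/2) * ∑ k, (y k - a k) ^ 2 + τ * ⨆ k, |y k| := by
  haveI : Nonempty (Fin C) := ⟨⟨0, hC⟩⟩
  have vi := proj_vi p (fun k => (1/τ) * |a k|) hp hmin
  have hsu : ∀ w : Fin C → ℝ, ∑ k, |w k| ≤ 1 →
      ∑ k, u k * w k ≤ ∑ k, u k * (Real.sign (a k) * p k) := by
    intro w hw
    have h1 := vi (fun k => Real.sign (a k) * w k) (by
      refine le_trans (Finset.sum_le_sum fun k _ => ?_) hw
      rw [abs_mul]
      exact mul_le_of_le_one_left (abs_nonneg _) (abs_rsign_le _))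
    have h2 : ∑ k, (u k * w k - u k * (Real.sign (a k) * p k)) ≤
        τ * ∑ k, ((1/τ) * |a k| - p k) * (Real.sign (a k) * w k - p k) := by
      rw [Finset.mul_sum]
      refine Finset.sum_le_sum fun k _ => ?_
      rw [hu]
      have e : τ * (((1/τ) * |a k| - p k) * (Real.sign (a k) * w k - p k))
          = (|a k| - τ * p k) * (Real.sign (a k) * w k - p k) := by
        field_simp
      rw [e]
      rcases lt_trichotomy (a k) 0 with h | h | h
      · rw [Real.sign_of_neg h, abs_of_neg h]
        apply le_of_eq; ring
      · rw [h]; simp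
        nlinarith [mul_nonneg hτ.le (mul_self_nonneg (p k))]
      · rw [Real.sign_of_pos h, abs_of_pos h]
        apply le_of_eq; ring
    rw [Finset.sum_sub_distrib] at h2
    have h3 := mul_nonpos_of_nonneg_of_nonpos hτ.le h1
    linarith
  have hsup : (⨆ k, |u k|) ≤ ∑ k, u k * (Real.sign (a k) * p k) := by
    refine ciSup_le fun k => ?_
    have h := hsu (Pi.single k (Real.sign (u k))) (by
      rw [Finset.sum_eq_single k]
      · simpa using abs_rsign_le (u k)
      · intro j _ hj; simp [hj]
      · simp)
    rw [Finset.sum_eq_single k] at h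
    · rw [Pi.single_eq_same] at h
      refine le_trans (le_of_eq ?_) h
      rcases lt_trichotomy (u k) 0 with h | h | h
      · rw [Real.sign_of_neg h, abs_of_neg h]; ring
      · rw [h]; simp
      · rw [Real.sign_of_pos h, abs_of_pos h]; ring
    · intro j _ hj; simp [hj]
    · simp
  have hy : ∑ k, y k * (Real.sign (a k) * p k) ≤ ⨆ k, |y k| := by
    have hS0 : 0 ≤ ⨆ k, |y k| := Real.iSup_nonneg fun k => abs_nonneg _
    calc ∑ k, y k * (Real.sign (a k) * p k) ≤ ∑ k, (⨆ k, |y k|) * |p k| := by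
          refine Finset.sum_le_sum fun k _ => ?_
          refine (le_abs_self _).trans ?_
          rw [abs_mul, abs_mul]
          refine mul_le_mul (le_ciSup (f := fun k => |y k|) (Set.finite_range _).bddAbove k) ?_
            (by positivity) hS0
          exact mul_le_of_le_one_left (abs_nonneg _) (abs_rsign_le _)
      _ = (⨆ k, |y k|) * ∑ k, |p k| := by rw [Finset.mul_sum]
      _ ≤ _ := mul_le_of_le_one_right hS0 hp
  have hid : (1/2) * ∑ k, (y k - a k) ^ 2 = (1/2) * ∑ k, (u k - a k) ^ 2
      + (1/2) * ∑ k, (y k - u k) ^ 2 + τ * ∑ k, u k * (Real.sign (a k) * p k)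
      - τ * ∑ k, y k * (Real.sign (a k) * p k) := by
    simp only [Finset.mul_sum]
    rw [← Finset.sum_add_distrib, ← Finset.sum_add_distrib, ← Finset.sum_sub_distrib]
    refine Finset.sum_congr rfl fun k _ => ?_
    rw [hu]; ring
  have h1 := mul_le_mul_of_nonneg_left hsup hτ.le
  have h2 := mul_le_mul_of_nonneg_left hy hτ.le
  linarith

/-- The proximity operator of the `ℓ^{∞,1,1}` norm is given by subtracting `τ` times
the signed Euclidean projection of `(1/τ)|A_{i,j,:}|` onto the unit `ℓ¹` ball. -/
theorem prox_linf11 (N M C : ℕ) (hN : 0 < N) (hM : 0 < M) (hC : 0 < C)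
    (τ : ℝ) (hτ : 0 < τ)
    (A : Fin N → Fin M → Fin C → ℝ)
    (P : Fin N → Fin M → Fin C → ℝ)
    (hP_mem : ∀ i j, ∑ k, |P i j k| ≤ 1)
    (hP_min : ∀ (i : Fin N) (j : Fin M) (w : Fin C → ℝ), ∑ k, |w k| ≤ 1 →
        ∑ k, (P i j k - (1/τ) * |A i j k|) ^ 2 ≤ ∑ k, (w k - (1/τ) * |A i j k|) ^ 2)
    (Ahat : Fin N → Fin M → Fin C → ℝ)
    (hAhat : ∀ i j k, Ahat i j k = A i j k - τ * Real.sign (A i j k) * P i j k) :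
    (∀ Y : Fin N → Fin M → Fin C → ℝ, objLinf11 τ A Ahat ≤ objLinf11 τ A Y) ∧
    (∀ Y : Fin N → Fin M → Fin C → ℝ, objLinf11 τ A Y ≤ objLinf11 τ A Ahat → Y = Ahat) := by
  have key : ∀ Y : Fin N → Fin M → Fin C → ℝ,
      objLinf11 τ A Ahat + (1/2) * ∑ i, ∑ j, ∑ k, (Y i j k - Ahat i j k) ^ 2
        ≤ objLinf11 τ A Y := by
    intro Y
    have h : ∑ i, ∑ j, ((1/2) * ∑ k, (Ahat i j k - A i j k) ^ 2 + τ * (⨆ k, |Ahat i j k|)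
          + (1/2) * ∑ k, (Y i j k - Ahat i j k) ^ 2)
        ≤ ∑ i, ∑ j, ((1/2) * ∑ k, (Y i j k - A i j k) ^ 2 + τ * ⨆ k, |Y i j k|) :=
      Finset.sum_le_sum fun i _ => Finset.sum_le_sum fun j _ =>
        fiber hC τ hτ (A i j) (P i j) (Ahat i j) (Y i j) (hP_mem i j) (hP_min i j) (hAhat i j)
    simp only [Finset.sum_add_distrib, ← Finset.mul_sum] at h
    exact h
  refine ⟨fun Y => ?_, fun Y hY => ?_⟩
  · have h := key Y
    have : 0 ≤ ∑ i, ∑ j, ∑ k, (Y i j k - Ahat i j k) ^ 2 := by positivity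
    linarith
  · have h := key Y
    have h0 : ∑ i, ∑ j, ∑ k, (Y i j k - Ahat i j k) ^ 2 = 0 :=
      le_antisymm (by linarith) (by positivity)
    funext i j k
    rw [Finset.sum_eq_zero_iff_of_nonneg (fun _ _ => by positivity)] at h0
    have h1 := h0 i (Finset.mem_univ _)
    rw [Finset.sum_eq_zero_iff_of_nonneg (fun _ _ => by positivity)] at h1
    have h2 := h1 j (Finset.mem_univ _)
    rw [Finset.sum_eq_zero_iff_of_nonneg (fun _ _ => by positivity)] at h2
    have h3 := h2 k (Finset.mem_univ _)
    exact sub_eq_zero.mp (pow_eq_zero_iff (two_ne_zero)|>.mp h3)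
end

section
/- Let N, M, C be positive natural numbers and τ > 0. For a tensor A ∈ ℝ^{N×M×C}, define for each index i the matrix Q^{(i)} ∈ ℝ^{M×C} as the Euclidean projection of the matrix (1/τ)|A_{i,:,:}| (componentwise absolute values) onto the closed unit ℓ¹ ball of M×C matrices {W : Σ_{j,k} |W_{j,k}| ≤ 1}. Then the tensor Â defined by Â_{i,j,k} := A_{i,j,k} − τ · sign(A_{i,j,k}) · Q^{(i)}_{j,k} is the unique minimizer over Y ∈ ℝ^{N×M×C} of ½‖Y − A‖₂² + τ ‖Y‖_{∞,∞,1}, where ‖Y‖_{∞,∞,1} := Σ_i max_{j,k} |Y_{i,j,k}|. -/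
/-- The objective `½‖Y − A‖₂² + τ‖Y‖_{∞,∞,1}`, where
`‖Y‖_{∞,∞,1} = Σ_i max_{j,k} |Y_{i,j,k}|`. -/
noncomputable def objLinfinf1 {N M C : ℕ} (τ : ℝ) (A Y : Fin N → Fin M → Fin C → ℝ) : ℝ :=
  (1/2) * ∑ i, ∑ j, ∑ k, (Y i j k - A i j k) ^ 2 + τ * ∑ i, ⨆ j, ⨆ k, |Y i j k|

theorem aux_vi {ι : Type*} [Fintype ι] (q a w : ι → ℝ)
    (hq : ∑ x, |q x| ≤ 1)
    (hmin : ∀ w : ι → ℝ, ∑ x, |w x| ≤ 1 → ∑ x, (q x - a x) ^ 2 ≤ ∑ x, (w x - a x) ^ 2)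
    (hw : ∑ x, |w x| ≤ 1) : ∑ x, (a x - q x) * (w x - q x) ≤ 0 := by
  by_contra! hpos
  set I := ∑ x, (a x - q x) * (w x - q x) with hI
  set D := ∑ x, (w x - q x) ^ 2 with hD
  have hD0 : 0 ≤ D := Finset.sum_nonneg fun x _ => sq_nonneg _
  have key : ∀ t : ℝ, 0 ≤ t → t ≤ 1 → 2 * t * I ≤ t ^ 2 * D := by
    intro t h0 h1
    have hb : ∑ x, |q x + t * (w x - q x)| ≤ 1 := by
      calc ∑ x, |q x + t * (w x - q x)| ≤ ∑ x, ((1 - t) * |q x| + t * |w x|) := by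
            apply Finset.sum_le_sum
            intro x _
            have : q x + t * (w x - q x) = (1 - t) * q x + t * w x := by ring
            rw [this]
            refine (abs_add_le _ _).trans ?_
            rw [abs_mul, abs_mul, abs_of_nonneg h0, abs_of_nonneg (sub_nonneg.2 h1)]
        _ = (1 - t) * ∑ x, |q x| + t * ∑ x, |w x| := by
            rw [Finset.sum_add_distrib, Finset.mul_sum, Finset.mul_sum]
        _ ≤ 1 := by nlinarith
    have h := hmin _ hb
    have e : ∑ x, (q x + t * (w x - q x) - a x) ^ 2
        = ∑ x, (q x - a x) ^ 2 - 2 * t * I + t ^ 2 * D := by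
      rw [hI, hD, Finset.mul_sum, Finset.mul_sum, ← Finset.sum_sub_distrib,
        ← Finset.sum_add_distrib]
      exact Finset.sum_congr rfl fun x _ => by ring
    linarith
  have h := key (I / (I + D)) (by positivity) (by rw [div_le_one (by positivity)]; linarith)
  have hs : 0 < I + D := by positivity
  have ht : 0 < I / (I + D) := by positivity
  have h2 : 2 * I ≤ I / (I + D) * D := by
    by_contra! hc
    nlinarith [mul_lt_mul_of_pos_left hc ht]
  rw [div_mul_eq_mul_div, le_div_iff₀ hs] at h2
  nlinarith [mul_nonneg hpos.le hD0, mul_pos hpos hpos]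

theorem aux_slice {ι : Type*} [Fintype ι] (τ : ℝ) (hτ : 0 < τ) (A q X Y : ι → ℝ)
    (hq : ∑ x, |q x| ≤ 1)
    (hmin : ∀ w : ι → ℝ, ∑ x, |w x| ≤ 1 →
      ∑ x, (q x - (1/τ) * |A x|) ^ 2 ≤ ∑ x, (w x - (1/τ) * |A x|) ^ 2)
    (hX : ∀ x, X x = A x - τ * Real.sign (A x) * q x)
    (sX sY : ℝ) (hsY : ∀ x, |Y x| ≤ sY) (hsY0 : 0 ≤ sY)
    (hsX : ∀ b, (∀ x, |X x| ≤ b) → sX ≤ b) :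
    (1/2) * ∑ x, (X x - A x) ^ 2 + τ * sX + (1/2) * ∑ x, (Y x - X x) ^ 2
      ≤ (1/2) * ∑ x, (Y x - A x) ^ 2 + τ * sY := by
  classical
  have hsgn : ∀ x, |Real.sign (A x)| ≤ 1 := by
    intro x
    rcases Real.sign_apply_eq (A x) with h | h | h <;> rw [h] <;> norm_num
  have hPY : ∑ x, Real.sign (A x) * q x * Y x ≤ sY := by
    calc ∑ x, Real.sign (A x) * q x * Y x ≤ ∑ x, |q x| * sY := by
          apply Finset.sum_le_sum
          intro x _
          refine (le_abs_self _).trans ?_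
          rw [abs_mul, abs_mul]
          apply mul_le_mul _ (hsY x) (abs_nonneg _) (abs_nonneg _)
          nlinarith [hsgn x, abs_nonneg (q x)]
      _ = (∑ x, |q x|) * sY := by rw [Finset.sum_mul]
      _ ≤ sY := by nlinarith
  have hPX : sX ≤ ∑ x, Real.sign (A x) * q x * X x := by
    apply hsX
    intro y
    have h1 : |X y| ≤ τ * |(1/τ) * |A y| - q y| := by
      rw [← abs_of_pos hτ, ← abs_mul, abs_of_pos hτ, mul_sub, ← mul_assoc,
        mul_one_div_cancel hτ.ne', one_mul, hX]
      rcases lt_trichotomy (A y) 0 with h | h | h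
      · rw [Real.sign_of_neg h, abs_of_neg h, ← abs_neg]
        apply le_of_eq; congr 1; ring
      · simp [h]
        positivity
      · rw [Real.sign_of_pos h, abs_of_pos h]
        apply le_of_eq; congr 1; ring
    have h2 : |(1/τ) * |A y| - q y| ≤ ∑ x, ((1/τ) * |A x| - q x) * q x := by
      have hv : ∀ s : ℝ, |s| ≤ 1 → ((1/τ) * |A y| - q y) * s
          ≤ ∑ x, ((1/τ) * |A x| - q x) * q x := by
        intro s hs
        have := aux_vi q (fun x => (1/τ) * |A x|) (fun x => if x = y then s else 0) hq hmin
          (by simpa [apply_ite abs] using hs)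
        simp only [mul_sub, Finset.sum_sub_distrib, mul_ite, mul_zero, Finset.sum_ite_eq',
          Finset.mem_univ, if_true] at this ⊢
        linarith
      rw [abs_le']
      constructor
      · simpa only [mul_one] using hv 1 (by norm_num)
      · simpa only [mul_neg, mul_one] using hv (-1) (by norm_num)
    have h3 : τ * ∑ x, ((1/τ) * |A x| - q x) * q x ≤ ∑ x, Real.sign (A x) * q x * X x := by
      rw [Finset.mul_sum]
      apply Finset.sum_le_sum
      intro x _
      have e : τ * (((1/τ) * |A x| - q x) * q x) = (|A x| - τ * q x) * q x := by
        field_simp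
      rw [e, hX]
      rcases lt_trichotomy (A x) 0 with h | h | h
      · rw [Real.sign_of_neg h, abs_of_neg h]
        apply le_of_eq; ring
      · simp [h]
        nlinarith [mul_nonneg hτ.le (mul_self_nonneg (q x))]
      · rw [Real.sign_of_pos h, abs_of_pos h]
        apply le_of_eq; ring
    exact h1.trans ((mul_le_mul_of_nonneg_left h2 hτ.le).trans h3)
  have e : ∑ x, (Y x - A x) ^ 2 = ∑ x, (X x - A x) ^ 2 + ∑ x, (Y x - X x) ^ 2
      - 2 * τ * ∑ x, Real.sign (A x) * q x * Y x + 2 * τ * ∑ x, Real.sign (A x) * q x * X x := by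
    rw [Finset.mul_sum, Finset.mul_sum, ← Finset.sum_add_distrib, ← Finset.sum_sub_distrib,
      ← Finset.sum_add_distrib]
    exact Finset.sum_congr rfl fun x _ => by rw [hX]; ring
  have h1 := mul_le_mul_of_nonneg_left hPY hτ.le
  have h2 := mul_le_mul_of_nonneg_left hPX hτ.le
  rw [e]
  linarith

theorem prox_linfinf1 (N M C : ℕ) (hN : 0 < N) (hM : 0 < M) (hC : 0 < C)
    (τ : ℝ) (hτ : 0 < τ)
    (A : Fin N → Fin M → Fin C → ℝ)
    (Q : Fin N → Fin M → Fin C → ℝ)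
    (hQ_mem : ∀ i, ∑ j, ∑ k, |Q i j k| ≤ 1)
    (hQ_min : ∀ (i : Fin N) (W : Fin M → Fin C → ℝ), ∑ j, ∑ k, |W j k| ≤ 1 →
        ∑ j, ∑ k, (Q i j k - (1/τ) * |A i j k|) ^ 2
          ≤ ∑ j, ∑ k, (W j k - (1/τ) * |A i j k|) ^ 2)
    (Ahat : Fin N → Fin M → Fin C → ℝ)
    (hAhat : ∀ i j k, Ahat i j k = A i j k - τ * Real.sign (A i j k) * Q i j k) :
    (∀ Y : Fin N → Fin M → Fin C → ℝ, objLinfinf1 τ A Ahat ≤ objLinfinf1 τ A Y) ∧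
    (∀ Y : Fin N → Fin M → Fin C → ℝ, objLinfinf1 τ A Y ≤ objLinfinf1 τ A Ahat → Y = Ahat) := by
  have hMn : Nonempty (Fin M) := ⟨⟨0, hM⟩⟩
  have hCn : Nonempty (Fin C) := ⟨⟨0, hC⟩⟩
  have main : ∀ Y : Fin N → Fin M → Fin C → ℝ,
      objLinfinf1 τ A Ahat + (1/2) * ∑ i, ∑ j, ∑ k, (Y i j k - Ahat i j k) ^ 2
        ≤ objLinfinf1 τ A Y := by
    intro Y
    have hi : ∀ i, (1/2) * ∑ j, ∑ k, (Ahat i j k - A i j k) ^ 2 + τ * (⨆ j, ⨆ k, |Ahat i j k|)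
        + (1/2) * ∑ j, ∑ k, (Y i j k - Ahat i j k) ^ 2
        ≤ (1/2) * ∑ j, ∑ k, (Y i j k - A i j k) ^ 2 + τ * (⨆ j, ⨆ k, |Y i j k|) := by
      intro i
      have := aux_slice (ι := Fin M × Fin C) τ hτ (fun x => A i x.1 x.2) (fun x => Q i x.1 x.2)
        (fun x => Ahat i x.1 x.2) (fun x => Y i x.1 x.2)
        (by simpa only [Fintype.sum_prod_type] using hQ_mem i)
        (by
          intro w hw
          have := hQ_min i (fun j k => w (j, k))
            (by simpa only [Fintype.sum_prod_type] using hw)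
          simpa only [Fintype.sum_prod_type] using this)
        (fun x => hAhat i x.1 x.2)
        (⨆ j, ⨆ k, |Ahat i j k|) (⨆ j, ⨆ k, |Y i j k|)
        (by
          intro x
          exact (le_ciSup (f := fun k => |Y i x.1 k|) (Set.finite_range _).bddAbove x.2).trans
            (le_ciSup (f := fun j => ⨆ k, |Y i j k|) (Set.finite_range _).bddAbove x.1))
        (Real.iSup_nonneg fun j => Real.iSup_nonneg fun k => abs_nonneg _)
        (fun b hb => ciSup_le fun j => ciSup_le fun k => hb (j, k))
      simpa only [Fintype.sum_prod_type] using this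
    have := Finset.sum_le_sum fun i (_ : i ∈ Finset.univ) => hi i
    simpa only [objLinfinf1, Finset.sum_add_distrib, ← Finset.mul_sum] using this
  constructor
  · intro Y
    have h := main Y
    have : 0 ≤ ∑ i, ∑ j, ∑ k, (Y i j k - Ahat i j k) ^ 2 := by positivity
    linarith
  · intro Y hY
    have h := main Y
    have h0 : ∑ i, ∑ j, ∑ k, (Y i j k - Ahat i j k) ^ 2 = 0 :=
      le_antisymm (by linarith) (by positivity)
    funext i j k
    rw [Finset.sum_eq_zero_iff_of_nonneg (fun _ _ => by positivity)] at h0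
    have h1 := h0 i (Finset.mem_univ _)
    rw [Finset.sum_eq_zero_iff_of_nonneg (fun _ _ => by positivity)] at h1
    have h2 := h1 j (Finset.mem_univ _)
    rw [Finset.sum_eq_zero_iff_of_nonneg (fun _ _ => by positivity)] at h2
    have h3 := h2 k (Finset.mem_univ _)
    exact sub_eq_zero.1 (pow_eq_zero_iff two_ne_zero |>.1 h3)
end

section
/- Let N, M, C be positive natural numbers and τ > 0. For a tensor A ∈ ℝ^{N×M×C}, define for each index i the matrix Q^{(i)} ∈ ℝ^{M×C} as the Euclidean projection of the matrix (1/τ)|A_{i,:,:}| (componentwise absolute values) onto the closed unit ℓ^{1,2} ball {W ∈ ℝ^{M×C} : sqrt( Σ_j ( Σ_k |W_{j,k}| )² ) ≤ 1}. Then the tensor Â defined by Â_{i,j,k} := A_{i,j,k} − τ · sign(A_{i,j,k}) · Q^{(i)}_{j,k} is the unique minimizer over Y ∈ ℝ^{N×M×C} of ½‖Y − A‖₂² + τ ‖Y‖_{∞,2,1}, where ‖Y‖_{∞,2,1} := Σ_i sqrt( Σ_j ( max_k |Y_{i,j,k}| )² ). -/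
/-- The objective `½‖Y − A‖₂² + τ‖Y‖_{∞,2,1}`, where
`‖Y‖_{∞,2,1} = Σ_i sqrt( Σ_j (max_k |Y_{i,j,k}|)² )`. -/
noncomputable def objLinf21 {N M C : ℕ} (τ : ℝ) (A Y : Fin N → Fin M → Fin C → ℝ) : ℝ :=
  (1/2) * ∑ i, ∑ j, ∑ k, (Y i j k - A i j k) ^ 2
    + τ * ∑ i, Real.sqrt (∑ j, (⨆ k, |Y i j k|) ^ 2)

/-- The `ℓ^{1,2}` norm of an `M × C` matrix: `sqrt( Σ_j (Σ_k |W_{j,k}|)² )`. -/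
noncomputable def l12Norm {M C : ℕ} (W : Fin M → Fin C → ℝ) : ℝ :=
  Real.sqrt (∑ j, (∑ k, |W j k|) ^ 2)

lemma ball_iff {M C : ℕ} (W : Fin M → Fin C → ℝ) :
    l12Norm W ≤ 1 ↔ ∑ j, (∑ k, |W j k|) ^ 2 ≤ 1 := by
  unfold l12Norm
  rw [Real.sqrt_le_left zero_le_one, one_pow]

lemma ball_convex {M C : ℕ} (P W : Fin M → Fin C → ℝ) (hP : l12Norm P ≤ 1) (hW : l12Norm W ≤ 1)
    (t : ℝ) (h0 : 0 ≤ t) (h1 : t ≤ 1) :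
    l12Norm (fun j k => P j k + t * (W j k - P j k)) ≤ 1 := by
  rw [ball_iff] at *
  have key : ∀ j, (∑ k, |P j k + t * (W j k - P j k)|) ^ 2
      ≤ (1 - t) * (∑ k, |P j k|) ^ 2 + t * (∑ k, |W j k|) ^ 2 := by
    intro j
    have hle : ∑ k, |P j k + t * (W j k - P j k)|
        ≤ (1 - t) * (∑ k, |P j k|) + t * (∑ k, |W j k|) := by
      rw [Finset.mul_sum, Finset.mul_sum, ← Finset.sum_add_distrib]
      apply Finset.sum_le_sum
      intro k _
      have e : P j k + t * (W j k - P j k) = (1 - t) * P j k + t * W j k := by ring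
      rw [e]
      refine (abs_add_le _ _).trans ?_
      rw [abs_mul, abs_mul, abs_of_nonneg h0, abs_of_nonneg (by linarith : (0 : ℝ) ≤ 1 - t)]
    have hnn : 0 ≤ ∑ k, |P j k + t * (W j k - P j k)| :=
      Finset.sum_nonneg fun k _ => abs_nonneg _
    refine (pow_le_pow_left₀ hnn hle 2).trans ?_
    nlinarith [mul_nonneg (mul_nonneg h0 (by linarith : (0 : ℝ) ≤ 1 - t))
      (sq_nonneg ((∑ k, |P j k|) - (∑ k, |W j k|)))]
  refine (Finset.sum_le_sum fun j _ => key j).trans ?_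
  rw [Finset.sum_add_distrib, ← Finset.mul_sum, ← Finset.mul_sum]
  nlinarith

/-- Variational inequality of the projection. -/
lemma proj_var {M C : ℕ} (P B : Fin M → Fin C → ℝ) (hP : l12Norm P ≤ 1)
    (hmin : ∀ W : Fin M → Fin C → ℝ, l12Norm W ≤ 1 →
      ∑ j, ∑ k, (P j k - B j k) ^ 2 ≤ ∑ j, ∑ k, (W j k - B j k) ^ 2)
    (W : Fin M → Fin C → ℝ) (hW : l12Norm W ≤ 1) :
    ∑ j, ∑ k, (B j k - P j k) * W j k ≤ ∑ j, ∑ k, (B j k - P j k) * P j k := by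
  set D := ∑ j, ∑ k, (W j k - P j k) ^ 2 with hD
  have hD0 : 0 ≤ D := Finset.sum_nonneg fun j _ => Finset.sum_nonneg fun k _ => sq_nonneg _
  by_contra hcon
  push Not at hcon
  set c := ∑ j, ∑ k, (B j k - P j k) * W j k - ∑ j, ∑ k, (B j k - P j k) * P j k with hc
  have hc0 : 0 < c := by linarith
  have step : ∀ t : ℝ, 0 ≤ t → t ≤ 1 → 0 ≤ -(2 * t * c) + t ^ 2 * D := by
    intro t h0 h1
    have h := hmin _ (ball_convex P W hP hW t h0 h1)
    have e : ∑ j, ∑ k, (P j k + t * (W j k - P j k) - B j k) ^ 2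
        = ∑ j, ∑ k, (P j k - B j k) ^ 2 + (-(2 * t * c) + t ^ 2 * D) := by
      rw [hc, hD]
      simp only [← Finset.sum_sub_distrib, Finset.mul_sum, ← Finset.sum_neg_distrib,
        ← Finset.sum_add_distrib]
      refine Finset.sum_congr rfl fun j _ => Finset.sum_congr rfl fun k _ => ?_
      ring
    rw [e] at h
    linarith
  have hcD : 0 < c + D := by linarith
  have h := step (c / (c + D)) (by positivity) (by rw [div_le_one hcD]; linarith)
  set t := c / (c + D) with ht
  have htc : t * (c + D) = c := by rw [ht]; field_simp
  have ht0 : 0 < t := by positivity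
  have : 0 ≤ t * (-(2 * c) + t * D) := by nlinarith
  have h2 : 0 ≤ -(2 * c) + t * D := nonneg_of_mul_nonneg_right this ht0
  nlinarith [mul_pos ht0 hc0]

lemma abs_le_sup {C : ℕ} (y : Fin C → ℝ) (k : Fin C) : |y k| ≤ ⨆ k, |y k| :=
  le_ciSup (f := fun k => |y k|) (Set.finite_range _).bddAbove k

/-- Hölder-type inequality. -/
lemma dual_le {M C : ℕ} (Y G : Fin M → Fin C → ℝ) (hG : l12Norm G ≤ 1) :
    ∑ j, ∑ k, Y j k * G j k ≤ Real.sqrt (∑ j, (⨆ k, |Y j k|) ^ 2) := by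
  have h1 : ∑ j, ∑ k, Y j k * G j k ≤ ∑ j, (⨆ k, |Y j k|) * ∑ k, |G j k| := by
    refine Finset.sum_le_sum fun j _ => ?_
    rw [Finset.mul_sum]
    refine Finset.sum_le_sum fun k _ => ?_
    refine (le_abs_self _).trans ?_
    rw [abs_mul]
    exact mul_le_mul_of_nonneg_right (abs_le_sup (Y j) k) (abs_nonneg _)
  have h2 := Real.sum_mul_le_sqrt_mul_sqrt Finset.univ
    (fun j => ⨆ k, |Y j k|) (fun j => ∑ k, |G j k|)
  refine h1.trans (h2.trans ?_)
  exact mul_le_of_le_one_right (Real.sqrt_nonneg _) hG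

lemma dual_attain {M C : ℕ} (hC : 0 < C) (Y : Fin M → Fin C → ℝ) :
    ∃ Z : Fin M → Fin C → ℝ, l12Norm Z ≤ 1 ∧
      ∑ j, ∑ k, Y j k * Z j k = Real.sqrt (∑ j, (⨆ k, |Y j k|) ^ 2) := by
  haveI : Nonempty (Fin C) := ⟨⟨0, hC⟩⟩
  have hex : ∀ j, ∃ k, |Y j k| = ⨆ k, |Y j k| := fun j =>
    exists_eq_ciSup_of_finite (f := fun k => |Y j k|)
  choose κ hκ using hex
  set S := ∑ j, (⨆ k, |Y j k|) ^ 2 with hS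
  have hS0 : 0 ≤ S := Finset.sum_nonneg fun j _ => sq_nonneg _
  set n := Real.sqrt S with hn
  have hn2 : n ^ 2 = S := Real.sq_sqrt hS0
  refine ⟨fun j k => if k = κ j then Y j k / n else 0, ?_, ?_⟩
  · rw [ball_iff]
    have e : ∀ j, ∑ k, |if k = κ j then Y j k / n else 0| = (⨆ k, |Y j k|) / n := by
      intro j
      rw [Finset.sum_eq_single (κ j)]
      · rw [if_pos rfl, abs_div, hκ, abs_of_nonneg (Real.sqrt_nonneg S)]
      · intro k _ hk
        simp [hk]
      · simp
    simp only [e, div_pow]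
    rw [← Finset.sum_div, ← hS, hn2]
    exact div_self_le_one S
  · have e : ∀ j, ∑ k, Y j k * (if k = κ j then Y j k / n else 0) = (⨆ k, |Y j k|) ^ 2 / n := by
      intro j
      rw [Finset.sum_eq_single (κ j)]
      · rw [if_pos rfl, ← hκ, sq_abs]; ring
      · intro k _ hk
        simp [hk]
      · simp
    simp only [e]
    rw [← Finset.sum_div, ← hS, ← hn2, sq, mul_self_div_self]

lemma ball_sign {M C : ℕ} (s W : Fin M → Fin C → ℝ) (hs : ∀ j k, |s j k| ≤ 1)
    (hW : l12Norm W ≤ 1) : l12Norm (fun j k => s j k * W j k) ≤ 1 := by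
  rw [ball_iff] at *
  refine le_trans (Finset.sum_le_sum fun j _ => ?_) hW
  refine pow_le_pow_left₀ (Finset.sum_nonneg fun k _ => abs_nonneg _) ?_ 2
  refine Finset.sum_le_sum fun k _ => ?_
  rw [abs_mul]
  exact mul_le_of_le_one_left (abs_nonneg _) (hs j k)

lemma slice {M C : ℕ} (hC : 0 < C) (τ : ℝ) (hτ : 0 < τ) (a P X : Fin M → Fin C → ℝ)
    (hP : l12Norm P ≤ 1)
    (hmin : ∀ W : Fin M → Fin C → ℝ, l12Norm W ≤ 1 →
        ∑ j, ∑ k, (P j k - (1/τ) * |a j k|) ^ 2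
          ≤ ∑ j, ∑ k, (W j k - (1/τ) * |a j k|) ^ 2)
    (hX : ∀ j k, X j k = a j k - τ * Real.sign (a j k) * P j k) (Y : Fin M → Fin C → ℝ) :
    (1/2) * ∑ j, ∑ k, (X j k - a j k) ^ 2 + τ * Real.sqrt (∑ j, (⨆ k, |X j k|) ^ 2)
      + (1/2) * ∑ j, ∑ k, (Y j k - X j k) ^ 2
    ≤ (1/2) * ∑ j, ∑ k, (Y j k - a j k) ^ 2 + τ * Real.sqrt (∑ j, (⨆ k, |Y j k|) ^ 2) := by
  have hs : ∀ j k, |Real.sign (a j k)| ≤ 1 := by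
    intro j k
    rcases Real.sign_apply_eq (a j k) with h | h | h <;> rw [h] <;> norm_num
  have hY := dual_le Y _ (ball_sign (fun j k => Real.sign (a j k)) P hs hP)
  obtain ⟨Z, hZ, hZX⟩ := dual_attain hC X
  have hv := proj_var P (fun j k => (1/τ) * |a j k|) hP hmin _
    (ball_sign (fun j k => Real.sign (a j k)) Z hs hZ)
  have e1 : ∑ j, ∑ k, X j k * Z j k
      = τ * ∑ j, ∑ k, ((1/τ) * |a j k| - P j k) * (Real.sign (a j k) * Z j k) := by
    simp only [Finset.mul_sum]
    refine Finset.sum_congr rfl fun j _ => Finset.sum_congr rfl fun k _ => ?_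
    rw [hX]
    rcases lt_trichotomy (a j k) 0 with h | h | h
    · rw [Real.sign_of_neg h, abs_of_neg h]; field_simp; ring
    · rw [h]; simp
    · rw [Real.sign_of_pos h, abs_of_pos h]; field_simp
  have e2 : τ * ∑ j, ∑ k, ((1/τ) * |a j k| - P j k) * P j k
      ≤ ∑ j, ∑ k, X j k * (Real.sign (a j k) * P j k) := by
    simp only [Finset.mul_sum]
    refine Finset.sum_le_sum fun j _ => Finset.sum_le_sum fun k _ => ?_
    rw [hX]
    rcases lt_trichotomy (a j k) 0 with h | h | h
    · rw [Real.sign_of_neg h, abs_of_neg h]; apply le_of_eq; field_simp; ring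
    · rw [h]; simp; nlinarith [mul_nonneg hτ.le (mul_self_nonneg (P j k))]
    · rw [Real.sign_of_pos h, abs_of_pos h]; apply le_of_eq; field_simp
  have hXX : Real.sqrt (∑ j, (⨆ k, |X j k|) ^ 2)
      ≤ ∑ j, ∑ k, X j k * (Real.sign (a j k) * P j k) := by
    rw [← hZX, e1]
    exact (mul_le_mul_of_nonneg_left hv hτ.le).trans e2
  have e3 : (1/2) * ∑ j, ∑ k, (Y j k - a j k) ^ 2
      = (1/2) * ∑ j, ∑ k, (X j k - a j k) ^ 2 + (1/2) * ∑ j, ∑ k, (Y j k - X j k) ^ 2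
        + τ * (∑ j, ∑ k, X j k * (Real.sign (a j k) * P j k)
          - ∑ j, ∑ k, Y j k * (Real.sign (a j k) * P j k)) := by
    simp only [← Finset.sum_sub_distrib, Finset.mul_sum, ← Finset.sum_add_distrib]
    refine Finset.sum_congr rfl fun j _ => Finset.sum_congr rfl fun k _ => ?_
    rw [hX]
    ring
  rw [e3]
  nlinarith [mul_le_mul_of_nonneg_left hXX hτ.le, mul_le_mul_of_nonneg_left hY hτ.le]

/-- The proximity operator of the `ℓ^{∞,2,1}` norm is given by subtracting `τ` times
the signed Euclidean projection of `(1/τ)|A_{i,:,:}|` onto the unit `ℓ^{1,2}` ball. -/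
theorem prox_linf21 (N M C : ℕ) (hN : 0 < N) (hM : 0 < M) (hC : 0 < C)
    (τ : ℝ) (hτ : 0 < τ)
    (A : Fin N → Fin M → Fin C → ℝ)
    (Q : Fin N → Fin M → Fin C → ℝ)
    (hQ_mem : ∀ i, l12Norm (Q i) ≤ 1)
    (hQ_min : ∀ (i : Fin N) (W : Fin M → Fin C → ℝ), l12Norm W ≤ 1 →
        ∑ j, ∑ k, (Q i j k - (1/τ) * |A i j k|) ^ 2
          ≤ ∑ j, ∑ k, (W j k - (1/τ) * |A i j k|) ^ 2)
    (Ahat : Fin N → Fin M → Fin C → ℝ)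
    (hAhat : ∀ i j k, Ahat i j k = A i j k - τ * Real.sign (A i j k) * Q i j k) :
    (∀ Y : Fin N → Fin M → Fin C → ℝ, objLinf21 τ A Ahat ≤ objLinf21 τ A Y) ∧
    (∀ Y : Fin N → Fin M → Fin C → ℝ, objLinf21 τ A Y ≤ objLinf21 τ A Ahat → Y = Ahat) := by
  have key : ∀ Y : Fin N → Fin M → Fin C → ℝ,
      objLinf21 τ A Ahat + (1/2) * ∑ i, ∑ j, ∑ k, (Y i j k - Ahat i j k) ^ 2
        ≤ objLinf21 τ A Y := by
    intro Y
    have h := Finset.sum_le_sum fun i (_ : i ∈ Finset.univ) =>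
      slice hC τ hτ (A i) (Q i) (Ahat i) (hQ_mem i) (hQ_min i) (hAhat i) (Y i)
    simp only [Finset.sum_add_distrib, ← Finset.mul_sum] at h
    exact h
  have hnn : ∀ Y : Fin N → Fin M → Fin C → ℝ,
      0 ≤ ∑ i, ∑ j, ∑ k, (Y i j k - Ahat i j k) ^ 2 := fun Y =>
    Finset.sum_nonneg fun i _ => Finset.sum_nonneg fun j _ =>
      Finset.sum_nonneg fun k _ => sq_nonneg _
  refine ⟨fun Y => by linarith [key Y, hnn Y], fun Y hY => ?_⟩
  have h0 : ∑ i, ∑ j, ∑ k, (Y i j k - Ahat i j k) ^ 2 = 0 :=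
    le_antisymm (by linarith [key Y]) (hnn Y)
  funext i j k
  have h1 := (Finset.sum_eq_zero_iff_of_nonneg (fun i _ => Finset.sum_nonneg fun j _ =>
      Finset.sum_nonneg fun k _ => sq_nonneg _)).1 h0 i (Finset.mem_univ i)
  have h2 := (Finset.sum_eq_zero_iff_of_nonneg (fun j _ =>
      Finset.sum_nonneg fun k _ => sq_nonneg _)).1 h1 j (Finset.mem_univ j)
  have h3 := (Finset.sum_eq_zero_iff_of_nonneg (fun k _ => sq_nonneg _)).1 h2 k (Finset.mem_univ k)
  have h4 := pow_eq_zero_iff (two_ne_zero) |>.1 h3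
  linarith
end

section
/- Let N, M, C be positive natural numbers and τ > 0. Let ‖·‖_b be a norm on the space of real M×C matrices and ‖·‖_a a norm on ℝ^N, with dual norms ‖·‖_{b*}, ‖·‖_{a*}, and assume ‖·‖_{a*} is absolute, i.e. ‖v‖_{a*} = ‖|v|‖_{a*} for every v ∈ ℝ^N. Then for tensors A, Â ∈ ℝ^{N×M×C}, Â is the unique minimizer over Y of ½‖Y − A‖₂² + τ ‖Y‖_{b,a} (that is, Â = prox_{τ‖·‖_{b,a}}(A)) if and only if ‖A − Â‖_{b*,a*} ≤ τ and ⟨A, Â⟩ = τ ‖Â‖_{b,a} + ‖Â‖₂². -/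
theorem gen_bound {V : Type*} [AddCommGroup V] [Module ℝ V] [FiniteDimensional ℝ V]
    (n : V → ℝ) (hadd : ∀ x y, n (x + y) ≤ n x + n y)
    (hsmul : ∀ (c : ℝ) x, n (c • x) = |c| * n x) (hdef : ∀ x, n x = 0 → x = 0) :
    (∀ f : V →ₗ[ℝ] ℝ, ∃ K : ℝ, 0 ≤ K ∧ ∀ x, f x ≤ K * n x) ∧
    (∀ u : V, ∃ f : V →ₗ[ℝ] ℝ, (∀ x, f x ≤ n x) ∧ f u = n u) := by
  let g : AddGroupNorm V :=
    { toFun := n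
      map_zero' := by simpa using hsmul 0 0
      add_le' := hadd
      neg' := fun x => by simpa using hsmul (-1) x
      eq_zero_of_map_eq_zero' := hdef }
  let _ : NormedAddCommGroup V := g.toNormedAddCommGroup
  let _ : NormedSpace ℝ V := { norm_smul_le := fun c x => (hsmul c x).le }
  have hn : ∀ x : V, ‖x‖ = n x := fun x => rfl
  constructor
  · intro f
    refine ⟨‖LinearMap.toContinuousLinearMap f‖, norm_nonneg _, fun x => ?_⟩
    have := (LinearMap.toContinuousLinearMap f).le_opNorm x
    exact (le_abs_self _).trans this
  · intro u
    obtain ⟨h, h1, h2⟩ := exists_dual_vector'' ℝ u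
    refine ⟨h.toLinearMap, fun x => ?_, h2⟩
    have := h.le_of_opNorm_le h1 x
    rw [one_mul] at this
    exact (le_abs_self _).trans this

theorem gen_holder {V : Type*} [AddCommGroup V] [Module ℝ V] [FiniteDimensional ℝ V]
    (n : V → ℝ) (h0 : ∀ x, 0 ≤ n x) (hadd : ∀ x y, n (x + y) ≤ n x + n y)
    (hsmul : ∀ (c : ℝ) x, n (c • x) = |c| * n x) (hdef : ∀ x, n x = 0 → x = 0)
    (f : V →ₗ[ℝ] ℝ) (x : V) :
    f x ≤ sSup {r : ℝ | ∃ y, n y ≤ 1 ∧ r = f y} * n x := by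
  obtain ⟨K, hK, hf⟩ := (gen_bound n hadd hsmul hdef).1 f
  have hb : BddAbove {r : ℝ | ∃ y, n y ≤ 1 ∧ r = f y} := by
    refine ⟨K, ?_⟩
    rintro r ⟨y, hy, rfl⟩
    exact (hf y).trans (by nlinarith)
  rcases (h0 x).eq_or_lt with h | h
  · have := hdef x h.symm
    subst this
    simp [← h]
  · have : f ((n x)⁻¹ • x) ≤ sSup {r : ℝ | ∃ y, n y ≤ 1 ∧ r = f y} := by
      apply le_csSup hb
      refine ⟨_, ?_, rfl⟩
      rw [hsmul, abs_of_pos (inv_pos.2 h), inv_mul_cancel₀ h.ne']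
    rw [map_smul, smul_eq_mul, inv_mul_le_iff₀ h] at this
    linarith

def vecL {N : ℕ} (x : Fin N → ℝ) : (Fin N → ℝ) →ₗ[ℝ] ℝ where
  toFun y := ∑ i, x i * y i
  map_add' y z := by simp [mul_add, Finset.sum_add_distrib]
  map_smul' c y := by simp [Finset.mul_sum, mul_left_comm]

def matL {M C : ℕ} (x : Fin M → Fin C → ℝ) : (Fin M → Fin C → ℝ) →ₗ[ℝ] ℝ where
  toFun y := ∑ j, ∑ k, x j k * y j k
  map_add' y z := by simp [mul_add, Finset.sum_add_distrib]
  map_smul' c y := by simp [Finset.mul_sum, mul_left_comm]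

theorem lin_eq_vecL {N : ℕ} (f : (Fin N → ℝ) →ₗ[ℝ] ℝ) :
    ∃ w : Fin N → ℝ, ∀ y, f y = ∑ i, w i * y i := by
  refine ⟨fun i => f (Pi.single i 1), fun y => ?_⟩
  rw [LinearMap.pi_apply_eq_sum_univ f y]
  refine Finset.sum_congr rfl fun i _ => ?_
  rw [smul_eq_mul, mul_comm]
  congr 2
  ext j
  simp [Pi.single_apply, eq_comm]

theorem na_mono {N : ℕ} (na : (Fin N → ℝ) → ℝ)
    (ha_nonneg : ∀ v, 0 ≤ na v)
    (ha_add : ∀ v w, na (v + w) ≤ na v + na w)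
    (ha_smul : ∀ (c : ℝ) v, na (c • v) = |c| * na v)
    (ha_def : ∀ v, na v = 0 → v = 0)
    (habs : ∀ v : Fin N → ℝ, dualNormVec na (fun i => |v i|) = dualNormVec na v)
    (u v : Fin N → ℝ) (huv : ∀ i, |u i| ≤ |v i|) : na u ≤ na v := by
  obtain ⟨f, hf, hfu⟩ := (gen_bound na ha_add ha_smul ha_def).2 u
  obtain ⟨w, hw⟩ := lin_eq_vecL f
  have hw1 : dualNormVec na w ≤ 1 := by
    apply csSup_le
    · exact ⟨_, 0, by simpa using (ha_smul 0 0).le.trans (by simp), rfl⟩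
    · rintro r ⟨y, hy, rfl⟩
      rw [← hw]
      exact (hf y).trans hy
  let w' : Fin N → ℝ := fun i => if 0 ≤ v i then |w i| else -|w i|
  have e : dualNormVec na w' = dualNormVec na w := by
    rw [← habs w', ← habs w]
    congr 1
    ext i
    by_cases h : 0 ≤ v i <;> simp [w', h]
  have h1 : ∑ i, w' i * v i ≤ dualNormVec na w' * na v :=
    gen_holder na ha_nonneg ha_add ha_smul ha_def (vecL w') v
  have h2 : na u ≤ ∑ i, w' i * v i := by
    rw [← hfu, hw]
    refine Finset.sum_le_sum fun i _ => ?_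
    have : w' i * v i = |w i| * |v i| := by
      by_cases h : 0 ≤ v i
      · simp [w', h, abs_of_nonneg h]
      · simp [w', h, abs_of_neg (not_le.1 h)]
    rw [this]
    calc w i * u i ≤ |w i * u i| := le_abs_self _
      _ = |w i| * |u i| := abs_mul _ _
      _ ≤ _ := mul_le_mul_of_nonneg_left (huv i) (abs_nonneg _)
  have := ha_nonneg v
  rw [e] at h1
  nlinarith

theorem tinner_add_right' {N M C : ℕ} (A B D : Fin N → Fin M → Fin C → ℝ) :
    tinner A (B + D) = tinner A B + tinner A D := by
  simp [tinner, mul_add, Finset.sum_add_distrib]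

theorem tinner_sub_right' {N M C : ℕ} (A B D : Fin N → Fin M → Fin C → ℝ) :
    tinner A (B - D) = tinner A B - tinner A D := by
  simp [tinner, mul_sub, Finset.sum_sub_distrib]

theorem tinner_comm' {N M C : ℕ} (A B : Fin N → Fin M → Fin C → ℝ) :
    tinner A B = tinner B A := by
  simp [tinner, mul_comm]

theorem tinner_smul_right' {N M C : ℕ} (c : ℝ) (A B : Fin N → Fin M → Fin C → ℝ) :
    tinner A (c • B) = c * tinner A B := by
  simp [tinner, Finset.mul_sum, mul_left_comm]

theorem tinner_self_nonneg' {N M C : ℕ} (A : Fin N → Fin M → Fin C → ℝ) :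
    0 ≤ tinner A A :=
  Finset.sum_nonneg fun _ _ => Finset.sum_nonneg fun _ _ => Finset.sum_nonneg fun _ _ =>
    mul_self_nonneg _

theorem tinner_self_eq_zero' {N M C : ℕ} (A : Fin N → Fin M → Fin C → ℝ)
    (h : tinner A A = 0) : A = 0 := by
  ext i j k
  have h1 := (Finset.sum_eq_zero_iff_of_nonneg (fun i _ => Finset.sum_nonneg fun j _ =>
    Finset.sum_nonneg fun k _ => mul_self_nonneg (A i j k))).1 h i (Finset.mem_univ _)
  have h2 := (Finset.sum_eq_zero_iff_of_nonneg (fun j _ =>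
    Finset.sum_nonneg fun k _ => mul_self_nonneg (A i j k))).1 h1 j (Finset.mem_univ _)
  have h3 := (Finset.sum_eq_zero_iff_of_nonneg (fun k _ =>
    mul_self_nonneg (A i j k))).1 h2 k (Finset.mem_univ _)
  exact mul_self_eq_zero.1 h3

theorem tinner_expand {N M C : ℕ} (A B Y : Fin N → Fin M → Fin C → ℝ) :
    tinner (Y - A) (Y - A) = tinner (B - A) (B - A) + tinner (Y - B) (Y - B)
      - 2 * (tinner (A - B) Y - tinner (A - B) B) := by
  simp only [tinner, Finset.mul_sum, ← Finset.sum_add_distrib, ← Finset.sum_sub_distrib]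
  refine Finset.sum_congr rfl fun i _ => Finset.sum_congr rfl fun j _ =>
    Finset.sum_congr rfl fun k _ => ?_
  simp only [Pi.sub_apply]
  ring

theorem small_quad (p q : ℝ) (hq : 0 ≤ q)
    (h : ∀ t : ℝ, 0 < t → t ≤ 1 → 0 ≤ t * p + t ^ 2 * q) : 0 ≤ p := by
  by_contra hp
  push Not at hp
  have ht : 0 < min 1 (-p / (2 * (q + 1))) := lt_min one_pos (by apply div_pos <;> linarith)
  have h1 := h _ ht (min_le_left _ _)
  have h2 : min 1 (-p / (2 * (q + 1))) * (2 * (q + 1)) ≤ -p := by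
    rw [← le_div_iff₀ (by linarith)]
    exact min_le_right _ _
  generalize min 1 (-p / (2 * (q + 1))) = t at *
  have h3 : 0 ≤ t * (p + t * q) := by linarith
  have := nonneg_of_mul_nonneg_right h3 ht
  nlinarith

/-- Optimality characterization of the proximal mapping of a collaborative norm:
`Â = prox_{τ‖·‖_{b,a}}(A)` iff `‖A − Â‖_{b*,a*} ≤ τ` and
`⟨A,Â⟩ = τ‖Â‖_{b,a} + ‖Â‖₂²`. -/
theorem prox_collaborative_norm_characterization (N M C : ℕ)
    (hN : 0 < N) (hM : 0 < M) (hC : 0 < C)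
    (τ : ℝ) (hτ : 0 < τ)
    (nb : (Fin M → Fin C → ℝ) → ℝ)
    (hb_nonneg : ∀ x, 0 ≤ nb x)
    (hb_add : ∀ x y, nb (x + y) ≤ nb x + nb y)
    (hb_smul : ∀ (c : ℝ) x, nb (c • x) = |c| * nb x)
    (hb_def : ∀ x, nb x = 0 → x = 0)
    (na : (Fin N → ℝ) → ℝ)
    (ha_nonneg : ∀ v, 0 ≤ na v)
    (ha_add : ∀ v w, na (v + w) ≤ na v + na w)
    (ha_smul : ∀ (c : ℝ) v, na (c • v) = |c| * na v)
    (ha_def : ∀ v, na v = 0 → v = 0)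
    (habs : ∀ v : Fin N → ℝ, dualNormVec na (fun i => |v i|) = dualNormVec na v)
    (A Ahat : Fin N → Fin M → Fin C → ℝ) :
    ((∀ Y : Fin N → Fin M → Fin C → ℝ,
        (1/2) * tinner (Ahat - A) (Ahat - A) + τ * collabNorm nb na Ahat
          ≤ (1/2) * tinner (Y - A) (Y - A) + τ * collabNorm nb na Y) ∧
      (∀ Y : Fin N → Fin M → Fin C → ℝ,
        (1/2) * tinner (Y - A) (Y - A) + τ * collabNorm nb na Y
          ≤ (1/2) * tinner (Ahat - A) (Ahat - A) + τ * collabNorm nb na Ahat → Y = Ahat))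
    ↔ (collabNorm (dualNormMat nb) (dualNormVec na) (A - Ahat) ≤ τ ∧
        tinner A Ahat = τ * collabNorm nb na Ahat + tinner Ahat Ahat) := by
  have mono := na_mono na ha_nonneg ha_add ha_smul ha_def habs
  set R := A - Ahat with hR
  have hA : tinner A Ahat = tinner R Ahat + tinner Ahat Ahat := by
    rw [tinner_comm' A, tinner_comm' R, hR, tinner_sub_right']; ring
  have hFsmul : ∀ (c : ℝ) Y, collabNorm nb na (c • Y) = |c| * collabNorm nb na Y := by
    intro c Y
    have : (fun i => nb ((c • Y) i)) = |c| • fun i => nb (Y i) := by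
      ext i
      simp [hb_smul]
    simp only [collabNorm, this, ha_smul, abs_abs]
  have hFadd : ∀ X Y, collabNorm nb na (X + Y) ≤ collabNorm nb na X + collabNorm nb na Y := by
    intro X Y
    refine le_trans (mono _ _ fun i => ?_) (ha_add (fun i => nb (X i)) (fun i => nb (Y i)))
    simp only [Pi.add_apply]
    rw [abs_of_nonneg (hb_nonneg _),
      abs_of_nonneg (add_nonneg (hb_nonneg _) (hb_nonneg _))]
    exact hb_add _ _
  constructor
  · rintro ⟨hmin, -⟩
    have key : ∀ Y, 0 ≤ (1/2) * tinner (Y - Ahat) (Y - Ahat)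
        - (tinner R Y - tinner R Ahat) + τ * (collabNorm nb na Y - collabNorm nb na Ahat) := by
      intro Y
      have := hmin Y
      rw [tinner_expand A Ahat Y] at this
      linarith
    have dir : ∀ Z, tinner R Z ≤ τ * collabNorm nb na Z := by
      intro Z
      have := small_quad (τ * collabNorm nb na Z - tinner R Z) ((1/2) * tinner Z Z)
        (by have := tinner_self_nonneg' Z; linarith) ?_
      · linarith
      intro t ht _
      have h1 := key (Ahat + t • Z)
      have h2 := hFadd Ahat (t • Z)
      rw [hFsmul, abs_of_pos ht] at h2
      rw [add_sub_cancel_left, tinner_smul_right', tinner_comm' (t • Z), tinner_smul_right',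
        tinner_add_right', tinner_smul_right'] at h1
      have h3 := mul_le_mul_of_nonneg_left h2 hτ.le
      linarith
    have hge : τ * collabNorm nb na Ahat ≤ tinner R Ahat := by
      have := small_quad (tinner R Ahat - τ * collabNorm nb na Ahat) ((1/2) * tinner Ahat Ahat)
        (by have := tinner_self_nonneg' Ahat; linarith) ?_
      · linarith
      intro t ht ht1
      have h1 := key ((1 - t) • Ahat)
      have e : (1 - t) • Ahat - Ahat = (-t) • Ahat := by
        rw [sub_smul, neg_smul, one_smul]; abel
      rw [e, tinner_smul_right', tinner_comm' ((-t) • Ahat), tinner_smul_right',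
        tinner_smul_right', hFsmul, abs_of_nonneg (by linarith)] at h1
      linarith
    refine ⟨?_, by rw [hA]; linarith [dir Ahat]⟩
    apply csSup_le
    · exact ⟨_, 0, by simpa using (ha_smul 0 0).le.trans (by simp), rfl⟩
    rintro r ⟨y, hy, rfl⟩
    apply le_of_forall_pos_le_add
    intro ε hε
    have hS : 0 ≤ ∑ i, |y i| := Finset.sum_nonneg fun i _ => abs_nonneg _
    set δ := ε / (∑ i, |y i| + 1) with hδ
    have hδ0 : 0 < δ := by positivity
    have hex : ∀ i, ∃ y' : Fin M → Fin C → ℝ, nb y' ≤ 1 ∧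
        dualNormMat nb (R i) - δ < ∑ j, ∑ k, R i j k * y' j k := by
      intro i
      have hne : {r : ℝ | ∃ y : Fin M → Fin C → ℝ, nb y ≤ 1 ∧
          r = ∑ j, ∑ k, R i j k * y j k}.Nonempty :=
        ⟨_, 0, by simpa using (hb_smul 0 0).le.trans (by simp), rfl⟩
      obtain ⟨_, ⟨y', h1, rfl⟩, h2⟩ := exists_lt_of_lt_csSup hne (sub_lt_self _ hδ0)
      exact ⟨y', h1, h2⟩
    choose Z hZ1 hZ2 using hex
    have hd : ∀ i, 0 ≤ dualNormMat nb (R i) := by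
      intro i
      apply Real.sSup_nonneg'
      exact ⟨0, ⟨0, by simpa using (hb_smul 0 0).le.trans (by simp), by simp⟩, le_rfl⟩
    have h1 := dir (fun i => |y i| • Z i)
    have h2 : collabNorm nb na (fun i => |y i| • Z i) ≤ 1 := by
      refine le_trans (mono _ y fun i => ?_) hy
      rw [abs_of_nonneg (hb_nonneg _), hb_smul, abs_abs]
      exact mul_le_of_le_one_right (abs_nonneg _) (hZ1 i)
    have h3 : ∑ i, dualNormMat nb (R i) * y i - δ * ∑ i, |y i|
        ≤ tinner R (fun i => |y i| • Z i) := by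
      rw [Finset.mul_sum, ← Finset.sum_sub_distrib]
      refine Finset.sum_le_sum fun i _ => ?_
      have e : ∑ j, ∑ k, R i j k * (|y i| • Z i) j k
          = |y i| * ∑ j, ∑ k, R i j k * Z i j k := by
        simp [Finset.mul_sum, mul_left_comm]
      rw [e]
      have a1 := mul_le_mul_of_nonneg_left (hZ2 i).le (abs_nonneg (y i))
      have a2 := mul_le_mul_of_nonneg_left (le_abs_self (y i)) (hd i)
      linarith
    have h4 : δ * ∑ i, |y i| ≤ ε := by
      have : δ * (∑ i, |y i| + 1) = ε := div_mul_cancel₀ _ (by positivity)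
      linarith
    have h5 := mul_le_mul_of_nonneg_left h2 hτ.le
    linarith
  · rintro ⟨h1, h2⟩
    have hold : ∀ Y, tinner R Y ≤ τ * collabNorm nb na Y := by
      intro Y
      have a1 : tinner R Y ≤ ∑ i, dualNormMat nb (R i) * nb (Y i) :=
        Finset.sum_le_sum fun i _ =>
          gen_holder nb hb_nonneg hb_add hb_smul hb_def (matL (R i)) (Y i)
      have a2 : ∑ i, dualNormMat nb (R i) * nb (Y i)
          ≤ collabNorm (dualNormMat nb) (dualNormVec na) R * collabNorm nb na Y :=
        gen_holder na ha_nonneg ha_add ha_smul ha_def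
          (vecL fun i => dualNormMat nb (R i)) (fun i => nb (Y i))
      have a3 := mul_le_mul_of_nonneg_right h1 (ha_nonneg fun i => nb (Y i))
      exact (a1.trans a2).trans a3
    have main : ∀ Y, (1/2) * tinner (Ahat - A) (Ahat - A) + τ * collabNorm nb na Ahat
        + (1/2) * tinner (Y - Ahat) (Y - Ahat)
          ≤ (1/2) * tinner (Y - A) (Y - A) + τ * collabNorm nb na Y := by
      intro Y
      rw [tinner_expand A Ahat Y]
      have := hold Y
      linarith
    refine ⟨fun Y => ?_, fun Y hY => ?_⟩
    · linarith [main Y, tinner_self_nonneg' (Y - Ahat)]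
    · have := main Y
      exact sub_eq_zero.1 (tinner_self_eq_zero' _
        (le_antisymm (by linarith) (tinner_self_nonneg' _)))
end

section
/- Let N₁, N₂, C be positive natural numbers. For each k ∈ {1,…,C}, let l¹_k : ZMod N₁ → ℝ and l²_k : ZMod N₂ → ℝ be admissible piecewise linear functions, and let c¹_k, c²_k ∈ {0, 1, −1}. Define z¹_k(i,j) := c¹_k l¹_k(i), z²_k(i,j) := c²_k l²_k(j), and u_k(i,j) := (Dᵀ_x z¹_k)(i,j) + (Dᵀ_y z²_k)(i,j) on the cyclic grid ZMod N₁ × ZMod N₂. Define J(w) := Σ_{i,j,k} ( |D_x w_k(i,j)| + |D_y w_k(i,j)| ) (the ℓ^{1,1,1} collaborative total variation). Then u = (u₁,…,u_C) satisfies u ∈ ∂J(u), i.e. J(w) ≥ J(u) + ⟨u, w − u⟩ for every w : ZMod N₁ × ZMod N₂ → ℝ^C. -/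
/-- Backward difference in the first (horizontal) direction on the cyclic grid. -/
def Dx {N₁ N₂ : ℕ} (w : ZMod N₁ → ZMod N₂ → ℝ) (i : ZMod N₁) (j : ZMod N₂) : ℝ :=
  w i j - w (i-1) j

/-- Backward difference in the second (vertical) direction on the cyclic grid. -/
def Dy {N₁ N₂ : ℕ} (w : ZMod N₁ → ZMod N₂ → ℝ) (i : ZMod N₁) (j : ZMod N₂) : ℝ :=
  w i j - w i (j-1)

/-- Adjoint of `Dx`. -/
def DxT {N₁ N₂ : ℕ} (z : ZMod N₁ → ZMod N₂ → ℝ) (i : ZMod N₁) (j : ZMod N₂) : ℝ :=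
  z i j - z (i+1) j

/-- Adjoint of `Dy`. -/
def DyT {N₁ N₂ : ℕ} (z : ZMod N₁ → ZMod N₂ → ℝ) (i : ZMod N₁) (j : ZMod N₂) : ℝ :=
  z i j - z i (j+1)

/-- The `ℓ^{1,1,1}` collaborative total variation on the cyclic grid. -/
noncomputable def J111 {N₁ N₂ C : ℕ} [NeZero N₁] [NeZero N₂]
    (w : Fin C → ZMod N₁ → ZMod N₂ → ℝ) : ℝ :=
  ∑ i, ∑ j, ∑ k, (|Dx (w k) i j| + |Dy (w k) i j|)

lemma sbp_aux {N : ℕ} [NeZero N] (a v : ZMod N → ℝ) :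
    ∑ i, (a i - a (i+1)) * v i = ∑ i, a i * (v i - v (i-1)) := by
  have h : ∑ i, a (i+1) * v i = ∑ i, a i * v (i-1) := by
    rw [← Equiv.sum_comp (Equiv.addRight (1 : ZMod N)) (fun i => a i * v (i-1))]
    simp
  simp only [sub_mul, mul_sub, Finset.sum_sub_distrib, h]

lemma point_eq (c x y t : ℝ) (hx : |x| ≤ 1) (hy : |y| ≤ 1) (ht : |t| ≤ 1)
    (hadm : (y - t) = (t - x) ∨ |t| = 1) (hc : c = 0 ∨ c = 1 ∨ c = -1) :
    c * t * (c * (2 * t - y - x)) = |c * (2 * t - y - x)| := by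
  rw [abs_le] at hx hy
  rcases hadm with h | h
  · have : 2 * t - y - x = 0 := by linarith
    simp [this]
  · rcases (abs_eq zero_le_one).1 h with rfl | rfl
    · rcases hc with rfl | rfl | rfl
      · simp
      · rw [abs_of_nonneg (by linarith)]; ring
      · rw [abs_of_nonpos (by linarith)]; ring
    · rcases hc with rfl | rfl | rfl
      · simp
      · rw [abs_of_nonpos (by linarith)]; ring
      · rw [abs_of_nonneg (by linarith)]; ring

lemma point_le (c t d : ℝ) (ht : |t| ≤ 1) (hc : c = 0 ∨ c = 1 ∨ c = -1) :
    c * t * d ≤ |d| := by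
  have h1 : |c| ≤ 1 := by rcases hc with rfl | rfl | rfl <;> simp
  have h2 : |c * t| ≤ 1 := by
    rw [abs_mul]; exact mul_le_one₀ h1 (abs_nonneg _) ht
  calc c * t * d ≤ |c * t * d| := le_abs_self _
    _ = |c * t| * |d| := abs_mul _ _
    _ ≤ 1 * |d| := mul_le_mul_of_nonneg_right h2 (abs_nonneg _)
    _ = |d| := one_mul _

/-- Singular vectors of the `ℓ^{1,1,1}` collaborative TV: with per-channel admissible
piecewise linear profiles `l¹_k`, `l²_k` and coefficients `c¹_k, c²_k ∈ {0, ±1}`, the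
image `u_k = Dᵀ_x z¹_k + Dᵀ_y z²_k` satisfies `u ∈ ∂J(u)`. -/
theorem singular_vector_l111 (N₁ N₂ C : ℕ) [NeZero N₁] [NeZero N₂] (hC : 0 < C)
    (l1 : Fin C → ZMod N₁ → ℝ) (l2 : Fin C → ZMod N₂ → ℝ)
    (hl1 : ∀ k i, |l1 k i| ≤ 1)
    (hadm1 : ∀ k (i : ZMod N₁),
      (l1 k (i+1) - l1 k i) = (l1 k i - l1 k (i-1)) ∨ |l1 k i| = 1)
    (hl2 : ∀ k j, |l2 k j| ≤ 1)
    (hadm2 : ∀ k (j : ZMod N₂),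
      (l2 k (j+1) - l2 k j) = (l2 k j - l2 k (j-1)) ∨ |l2 k j| = 1)
    (c1 c2 : Fin C → ℝ)
    (hc1 : ∀ k, c1 k = 0 ∨ c1 k = 1 ∨ c1 k = -1)
    (hc2 : ∀ k, c2 k = 0 ∨ c2 k = 1 ∨ c2 k = -1)
    (u : Fin C → ZMod N₁ → ZMod N₂ → ℝ)
    (hu : ∀ k i j, u k i j =
        DxT (fun i' _ => c1 k * l1 k i') i j + DyT (fun _ j' => c2 k * l2 k j') i j) :
    ∀ w : Fin C → ZMod N₁ → ZMod N₂ → ℝ,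
      J111 u + ∑ i, ∑ j, ∑ k, u k i j * (w k i j - u k i j) ≤ J111 w := by
  intro w
  have key : ∀ v : Fin C → ZMod N₁ → ZMod N₂ → ℝ,
      ∑ i, ∑ j, ∑ k, u k i j * v k i j =
      ∑ i, ∑ j, ∑ k, (c1 k * l1 k i * Dx (v k) i j + c2 k * l2 k j * Dy (v k) i j) := by
    intro v
    have hA : ∑ i, ∑ j, ∑ k, (c1 k * l1 k i - c1 k * l1 k (i+1)) * v k i j =
        ∑ i, ∑ j, ∑ k, c1 k * l1 k i * Dx (v k) i j := by
      rw [Finset.sum_comm]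
      conv_rhs => rw [Finset.sum_comm]
      refine Finset.sum_congr rfl fun j _ => ?_
      rw [Finset.sum_comm]
      conv_rhs => rw [Finset.sum_comm]
      refine Finset.sum_congr rfl fun k _ => ?_
      exact sbp_aux (fun i => c1 k * l1 k i) (fun i => v k i j)
    have hB : ∑ i, ∑ j, ∑ k, (c2 k * l2 k j - c2 k * l2 k (j+1)) * v k i j =
        ∑ i, ∑ j, ∑ k, c2 k * l2 k j * Dy (v k) i j := by
      refine Finset.sum_congr rfl fun i _ => ?_
      rw [Finset.sum_comm]
      conv_rhs => rw [Finset.sum_comm]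
      refine Finset.sum_congr rfl fun k _ => ?_
      exact sbp_aux (fun j => c2 k * l2 k j) (fun j => v k i j)
    simp only [hu, DxT, DyT, add_mul, Finset.sum_add_distrib, hA, hB]
  have hJu : ∑ i, ∑ j, ∑ k, u k i j * u k i j = J111 u := by
    rw [key u, J111]
    refine Finset.sum_congr rfl fun i _ => Finset.sum_congr rfl fun j _ =>
      Finset.sum_congr rfl fun k _ => ?_
    have e1 : Dx (u k) i j = c1 k * (2 * l1 k i - l1 k (i+1) - l1 k (i-1)) := by
      simp only [Dx, hu, DxT, DyT, sub_add_cancel]; ring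
    have e2 : Dy (u k) i j = c2 k * (2 * l2 k j - l2 k (j+1) - l2 k (j-1)) := by
      simp only [Dy, hu, DxT, DyT, sub_add_cancel]; ring
    rw [e1, e2, point_eq _ _ _ _ (hl1 k _) (hl1 k _) (hl1 k _) (hadm1 k i) (hc1 k),
      point_eq _ _ _ _ (hl2 k _) (hl2 k _) (hl2 k _) (hadm2 k j) (hc2 k)]
  have hJw : ∑ i, ∑ j, ∑ k, u k i j * w k i j ≤ J111 w := by
    rw [key w, J111]
    exact Finset.sum_le_sum fun i _ => Finset.sum_le_sum fun j _ =>
      Finset.sum_le_sum fun k _ => add_le_add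
        (point_le _ _ _ (hl1 k i) (hc1 k)) (point_le _ _ _ (hl2 k j) (hc2 k))
  simp only [mul_sub, Finset.sum_sub_distrib]
  linarith
end

section
/- Let N₁, N₂, C be positive natural numbers. Let l¹ : ZMod N₁ → ℝ and l² : ZMod N₂ → ℝ be admissible piecewise linear functions (the same for all channels), and let c¹, c² ∈ ℝ^C satisfy ‖c¹‖₂ = ‖c²‖₂ = 1. Define z¹_k(i,j) := c¹_k l¹(i), z²_k(i,j) := c²_k l²(j), and u_k(i,j) := (Dᵀ_x z¹_k)(i,j) + (Dᵀ_y z²_k)(i,j) on the cyclic grid ZMod N₁ × ZMod N₂. Define J(w) := Σ_{i,j} ( sqrt(Σ_k (D_x w_k(i,j))²) + sqrt(Σ_k (D_y w_k(i,j))²) ) (the ℓ^{2,1,1} collaborative total variation). Then u = (u₁,…,u_C) satisfies u ∈ ∂J(u), i.e. J(w) ≥ J(u) + ⟨u, w − u⟩ for every w : ZMod N₁ × ZMod N₂ → ℝ^C. -/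
/-- The `ℓ^{2,1,1}` collaborative total variation on the cyclic grid. -/
noncomputable def J211 {N₁ N₂ C : ℕ} [NeZero N₁] [NeZero N₂]
    (w : Fin C → ZMod N₁ → ZMod N₂ → ℝ) : ℝ :=
  ∑ i, ∑ j, (Real.sqrt (∑ k, (Dx (w k) i j) ^ 2) + Real.sqrt (∑ k, (Dy (w k) i j) ^ 2))

lemma sv_shift {N : ℕ} [NeZero N] (l v : ZMod N → ℝ) :
    ∑ i, (l i - l (i+1)) * v i = ∑ i, l i * (v i - v (i-1)) := by
  have h : ∑ i, l (i+1) * v i = ∑ i, l i * v (i-1) := by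
    rw [← Equiv.sum_comp (Equiv.addRight (1 : ZMod N)) (fun i => l i * v (i-1))]
    simp
  simp only [sub_mul, mul_sub, Finset.sum_sub_distrib, h]

lemma sv_adj {N₁ N₂ C : ℕ} [NeZero N₁] [NeZero N₂]
    (l1 : ZMod N₁ → ℝ) (l2 : ZMod N₂ → ℝ) (c1 c2 : Fin C → ℝ)
    (u : Fin C → ZMod N₁ → ZMod N₂ → ℝ)
    (hu : ∀ k i j, u k i j =
        DxT (fun i' _ => c1 k * l1 i') i j + DyT (fun _ j' => c2 k * l2 j') i j)
    (v : Fin C → ZMod N₁ → ZMod N₂ → ℝ) :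
    ∑ i, ∑ j, ∑ k, u k i j * v k i j =
      ∑ i, ∑ j, (l1 i * ∑ k, c1 k * Dx (v k) i j + l2 j * ∑ k, c2 k * Dy (v k) i j) := by
  have e1 : ∀ i j, ∑ k, u k i j * v k i j
      = (l1 i - l1 (i+1)) * (∑ k, c1 k * v k i j) + (l2 j - l2 (j+1)) * (∑ k, c2 k * v k i j) := by
    intro i j
    rw [Finset.mul_sum, Finset.mul_sum, ← Finset.sum_add_distrib]
    refine Finset.sum_congr rfl fun k _ => ?_
    rw [hu]; simp only [DxT, DyT]; ring
  have e2 : ∀ i j, ∑ k, c1 k * Dx (v k) i j = ∑ k, c1 k * v k i j - ∑ k, c1 k * v k (i-1) j := by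
    intro i j
    rw [← Finset.sum_sub_distrib]
    exact Finset.sum_congr rfl fun k _ => by simp only [Dx]; ring
  have e3 : ∀ i j, ∑ k, c2 k * Dy (v k) i j = ∑ k, c2 k * v k i j - ∑ k, c2 k * v k i (j-1) := by
    intro i j
    rw [← Finset.sum_sub_distrib]
    exact Finset.sum_congr rfl fun k _ => by simp only [Dy]; ring
  simp only [e1, e2, e3, Finset.sum_add_distrib]
  congr 1
  · rw [Finset.sum_comm]
    conv_rhs => rw [Finset.sum_comm]
    exact Finset.sum_congr rfl fun j _ => sv_shift l1 (fun i => ∑ k, c1 k * v k i j)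
  · exact Finset.sum_congr rfl fun i _ => sv_shift l2 (fun j => ∑ k, c2 k * v k i j)

lemma sv_cs {C : ℕ} (c d : Fin C → ℝ) (hc : Real.sqrt (∑ k, (c k) ^ 2) = 1) (t : ℝ)
    (ht : |t| ≤ 1) : t * ∑ k, c k * d k ≤ Real.sqrt (∑ k, (d k) ^ 2) := by
  have h : |∑ k, c k * d k| ≤ Real.sqrt (∑ k, (d k) ^ 2) := by
    apply Real.abs_le_sqrt
    have := Finset.sum_mul_sq_le_sq_mul_sq Finset.univ c d
    rw [Real.sqrt_eq_one] at hc
    rwa [hc, one_mul] at this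
  calc t * ∑ k, c k * d k ≤ |t| * |∑ k, c k * d k| := by
        rw [← abs_mul]; exact le_abs_self _
    _ ≤ 1 * |∑ k, c k * d k| := by gcongr
    _ ≤ _ := by rwa [one_mul]

lemma sv_eq {C : ℕ} (c d : Fin C → ℝ) (hc : Real.sqrt (∑ k, (c k) ^ 2) = 1) (x y z : ℝ)
    (hx : |x| ≤ 1) (hz : |z| ≤ 1) (h : z - y = y - x ∨ |y| = 1)
    (hd : ∀ k, d k = c k * (2 * y - z - x)) :
    Real.sqrt (∑ k, (d k) ^ 2) = y * ∑ k, c k * d k := by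
  rw [Real.sqrt_eq_one] at hc
  have h1 : ∑ k, (d k) ^ 2 = (2 * y - z - x) ^ 2 := by
    simp only [hd, mul_pow, ← Finset.sum_mul, hc, one_mul]
  have h2 : ∑ k, c k * d k = 2 * y - z - x := by
    simp only [hd, ← mul_assoc, ← pow_two, ← Finset.sum_mul, hc, one_mul]
  rw [h1, h2, Real.sqrt_sq_eq_abs]
  rw [abs_le] at hx hz
  rcases h with h | h
  · have : 2 * y - z - x = 0 := by linarith
    rw [this]; simp
  · rcases eq_or_eq_neg_of_abs_eq h with h | h
    · rw [h, abs_of_nonneg] <;> linarith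
    · rw [h, abs_of_nonpos] <;> linarith

/-- Singular vectors of the `ℓ^{2,1,1}` collaborative TV: with common admissible
piecewise linear profiles `l¹`, `l²` and coefficient vectors `c¹, c²` of unit
Euclidean norm, the image `u_k = Dᵀ_x z¹_k + Dᵀ_y z²_k` satisfies `u ∈ ∂J(u)`. -/
theorem singular_vector_l211 (N₁ N₂ C : ℕ) [NeZero N₁] [NeZero N₂] (hC : 0 < C)
    (l1 : ZMod N₁ → ℝ) (l2 : ZMod N₂ → ℝ)
    (hl1 : ∀ i, |l1 i| ≤ 1)
    (hadm1 : ∀ i : ZMod N₁, (l1 (i+1) - l1 i) = (l1 i - l1 (i-1)) ∨ |l1 i| = 1)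
    (hl2 : ∀ j, |l2 j| ≤ 1)
    (hadm2 : ∀ j : ZMod N₂, (l2 (j+1) - l2 j) = (l2 j - l2 (j-1)) ∨ |l2 j| = 1)
    (c1 c2 : Fin C → ℝ)
    (hc1 : Real.sqrt (∑ k, (c1 k) ^ 2) = 1)
    (hc2 : Real.sqrt (∑ k, (c2 k) ^ 2) = 1)
    (u : Fin C → ZMod N₁ → ZMod N₂ → ℝ)
    (hu : ∀ k i j, u k i j =
        DxT (fun i' _ => c1 k * l1 i') i j + DyT (fun _ j' => c2 k * l2 j') i j) :
    ∀ w : Fin C → ZMod N₁ → ZMod N₂ → ℝ,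
      J211 u + ∑ i, ∑ j, ∑ k, u k i j * (w k i j - u k i j) ≤ J211 w := by
  intro w
  have hJu : J211 u = ∑ i, ∑ j, ∑ k, u k i j * u k i j := by
    rw [sv_adj l1 l2 c1 c2 u hu u, J211]
    refine Finset.sum_congr rfl fun i _ => Finset.sum_congr rfl fun j _ => ?_
    congr 1
    · refine sv_eq c1 _ hc1 (l1 (i-1)) (l1 i) (l1 (i+1)) (hl1 _) (hl1 _) (hadm1 i) fun k => ?_
      simp only [Dx, hu, DxT, DyT, sub_add_cancel]; ring
    · refine sv_eq c2 _ hc2 (l2 (j-1)) (l2 j) (l2 (j+1)) (hl2 _) (hl2 _) (hadm2 j) fun k => ?_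
      simp only [Dy, hu, DxT, DyT, sub_add_cancel]; ring
  have hw : ∑ i, ∑ j, ∑ k, u k i j * w k i j ≤ J211 w := by
    rw [sv_adj l1 l2 c1 c2 u hu w, J211]
    exact Finset.sum_le_sum fun i _ => Finset.sum_le_sum fun j _ =>
      add_le_add (sv_cs c1 _ hc1 _ (hl1 i)) (sv_cs c2 _ hc2 _ (hl2 j))
  simp only [mul_sub, Finset.sum_sub_distrib]
  linarith
end

section
/- Let N₁, N₂, C be positive natural numbers. Let l¹ : ZMod N₁ → ℝ and l² : ZMod N₂ → ℝ be admissible piecewise linear functions, and let c¹, c² ∈ {0, 1, −1}^C. For r ∈ {1,2}, let ‖c^r‖₀ denote the number of nonzero entries of c^r, and define z¹_k(i,j) := (c¹_k/‖c¹‖₀) l¹(i) if ‖c¹‖₀ ≠ 0 and z¹_k(i,j) := 0 otherwise, and z²_k(i,j) := (c²_k/‖c²‖₀) l²(j) if ‖c²‖₀ ≠ 0 and z²_k(i,j) := 0 otherwise. Define u_k(i,j) := (Dᵀ_x z¹_k)(i,j) + (Dᵀ_y z²_k)(i,j) on the cyclic grid ZMod N₁ × ZMod N₂, and J(w) := Σ_{i,j}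 ( max_k |D_x w_k(i,j)| + max_k |D_y w_k(i,j)| ) (the ℓ^{∞,1,1} collaborative total variation). Then u = (u₁,…,u_C) satisfies u ∈ ∂J(u), i.e. J(w) ≥ J(u) + ⟨u, w − u⟩ for every w : ZMod N₁ × ZMod N₂ → ℝ^C. -/
/-- The `ℓ^{∞,1,1}` collaborative total variation on the cyclic grid. -/
noncomputable def Jinf11 {N₁ N₂ C : ℕ} [NeZero N₁] [NeZero N₂]
    (w : Fin C → ZMod N₁ → ZMod N₂ → ℝ) : ℝ :=
  ∑ i, ∑ j, ((⨆ k, |Dx (w k) i j|) + (⨆ k, |Dy (w k) i j|))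

/-- Number of nonzero components of a vector `c ∈ ℝ^C` (the `ℓ⁰` "norm"). -/
noncomputable def l0norm {C : ℕ} (c : Fin C → ℝ) : ℕ :=
  (Finset.univ.filter fun k => c k ≠ 0).card

lemma aux_sum_sq {C : ℕ} (c : Fin C → ℝ) (hc : ∀ k, c k = 0 ∨ c k = 1 ∨ c k = -1) :
    ∑ k, c k * c k = (l0norm c : ℝ) := by
  unfold l0norm
  rw [Finset.card_filter]
  push_cast
  refine Finset.sum_congr rfl fun k _ => ?_
  rcases hc k with h | h | h <;> simp [h]

lemma aux_sum_abs {C : ℕ} (c : Fin C → ℝ) (hc : ∀ k, c k = 0 ∨ c k = 1 ∨ c k = -1) :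
    ∑ k, |c k| = (l0norm c : ℝ) := by
  rw [← aux_sum_sq c hc]
  refine Finset.sum_congr rfl fun k _ => ?_
  rcases hc k with h | h | h <;> simp [h]

lemma aux_le {C : ℕ} (c : Fin C → ℝ) (hc : ∀ k, c k = 0 ∨ c k = 1 ∨ c k = -1)
    (l : ℝ) (hl : |l| ≤ 1) (z : Fin C → ℝ)
    (hz : ∀ k, z k = if l0norm c = 0 then 0 else (c k / (l0norm c : ℝ)) * l)
    (v : Fin C → ℝ) : ∑ k, z k * v k ≤ ⨆ k, |v k| := by
  have hS : ∀ k, |v k| ≤ ⨆ k, |v k| := fun k => le_ciSup (f := fun k => |v k|) (Finite.bddAbove_range _) k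
  have hS0 : 0 ≤ ⨆ k, |v k| := Real.iSup_nonneg fun k => abs_nonneg _
  by_cases hn : l0norm c = 0
  · simpa [hz, hn] using hS0
  have hpos : (0 : ℝ) < l0norm c := by positivity
  calc ∑ k, z k * v k ≤ ∑ k, |c k| / (l0norm c : ℝ) * ⨆ k, |v k| := by
        refine Finset.sum_le_sum fun k _ => (le_abs_self _).trans ?_
        rw [hz, if_neg hn, abs_mul, abs_mul, abs_div, abs_of_pos hpos]
        refine mul_le_mul ?_ (hS k) (abs_nonneg _) (by positivity)
        exact mul_le_of_le_one_right (by positivity) hl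
    _ = ⨆ k, |v k| := by
        rw [← Finset.sum_mul, ← Finset.sum_div, aux_sum_abs c hc, div_self hpos.ne', one_mul]

lemma aux_ge {C : ℕ} (hC : 0 < C) (c : Fin C → ℝ) (hc : ∀ k, c k = 0 ∨ c k = 1 ∨ c k = -1)
    (l d : ℝ) (hl : l * d = |d|) (z g : Fin C → ℝ)
    (hz : ∀ k, z k = if l0norm c = 0 then 0 else (c k / (l0norm c : ℝ)) * l)
    (hg : ∀ k, g k = if l0norm c = 0 then 0 else (c k / (l0norm c : ℝ)) * d) :
    ⨆ k, |g k| ≤ ∑ k, z k * g k := by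
  haveI : Nonempty (Fin C) := ⟨⟨0, hC⟩⟩
  by_cases hn : l0norm c = 0
  · simp [hz, hg, hn]
  have hpos : (0 : ℝ) < l0norm c := by positivity
  have h1 : ∑ k, z k * g k = |d| / l0norm c := by
    have : ∀ k, z k * g k = (c k * c k) * (|d| / (l0norm c * l0norm c)) := by
      intro k
      rw [hz, hg, if_neg hn, if_neg hn, ← hl]
      field_simp
    simp_rw [this]
    rw [← Finset.sum_mul, aux_sum_sq c hc]
    field_simp
  rw [h1]
  refine ciSup_le fun k => ?_
  rw [hg, if_neg hn, abs_mul, abs_div, abs_of_pos hpos]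
  have : |c k| ≤ 1 := by rcases hc k with h | h | h <;> simp [h]
  rw [div_mul_eq_mul_div]
  gcongr
  exact mul_le_of_le_one_left (abs_nonneg _) this

lemma aux_parts {N : ℕ} [NeZero N] (z v : ZMod N → ℝ) :
    ∑ i, (z i - z (i+1)) * v i = ∑ i, z i * (v i - v (i-1)) := by
  simp_rw [sub_mul, mul_sub, Finset.sum_sub_distrib]
  congr 1
  rw [← Equiv.sum_comp (Equiv.addRight (1 : ZMod N)) (fun i => z i * v (i-1))]
  simp

lemma aux_d {N : ℕ} (l : ZMod N → ℝ) (hl : ∀ i, |l i| ≤ 1)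
    (hadm : ∀ i : ZMod N, (l (i+1) - l i) = (l i - l (i-1)) ∨ |l i| = 1) (i : ZMod N) :
    l i * ((l i - l (i+1)) - (l (i-1) - l i)) = |(l i - l (i+1)) - (l (i-1) - l i)| := by
  have h1 := abs_le.1 (hl (i+1))
  have h2 := abs_le.1 (hl (i-1))
  rcases hadm i with h | h
  · have : (l i - l (i+1)) - (l (i-1) - l i) = 0 := by linarith
    simp [this]
  · rcases eq_or_eq_neg_of_abs_eq h with h | h <;> rw [h]
    · rw [abs_of_nonneg (by linarith)]; ring
    · rw [abs_of_nonpos (by linarith)]; ring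

lemma aux_inner {N₁ N₂ C : ℕ} [NeZero N₁] [NeZero N₂]
    (z1 : Fin C → ZMod N₁ → ℝ) (z2 : Fin C → ZMod N₂ → ℝ)
    (u w : Fin C → ZMod N₁ → ZMod N₂ → ℝ)
    (hu : ∀ k i j, u k i j =
        DxT (fun i' _ => z1 k i') i j + DyT (fun _ j' => z2 k j') i j) :
    ∑ i, ∑ j, ∑ k, u k i j * w k i j =
      ∑ i, ∑ j, ((∑ k, z1 k i * Dx (w k) i j) + ∑ k, z2 k j * Dy (w k) i j) := by
  simp_rw [hu, DxT, DyT, add_mul, Finset.sum_add_distrib, Dx, Dy]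
  congr 1
  · rw [Finset.sum_comm]
    conv_rhs => rw [Finset.sum_comm]
    refine Finset.sum_congr rfl fun j _ => ?_
    rw [Finset.sum_comm]
    conv_rhs => rw [Finset.sum_comm]
    exact Finset.sum_congr rfl fun k _ => aux_parts (z1 k) (fun i => w k i j)
  · refine Finset.sum_congr rfl fun i _ => ?_
    rw [Finset.sum_comm]
    conv_rhs => rw [Finset.sum_comm]
    exact Finset.sum_congr rfl fun k _ => aux_parts (z2 k) (fun j => w k i j)

/-- Singular vectors of the `ℓ^{∞,1,1}` collaborative TV: with common admissible
piecewise linear profiles `l¹`, `l²` and coefficients `c¹_k, c²_k ∈ {0, ±1}`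
normalized by the number of nonzero entries, the image
`u_k = Dᵀ_x z¹_k + Dᵀ_y z²_k` satisfies `u ∈ ∂J(u)`. -/
theorem singular_vector_linf11 (N₁ N₂ C : ℕ) [NeZero N₁] [NeZero N₂] (hC : 0 < C)
    (l1 : ZMod N₁ → ℝ) (l2 : ZMod N₂ → ℝ)
    (hl1 : ∀ i, |l1 i| ≤ 1)
    (hadm1 : ∀ i : ZMod N₁, (l1 (i+1) - l1 i) = (l1 i - l1 (i-1)) ∨ |l1 i| = 1)
    (hl2 : ∀ j, |l2 j| ≤ 1)
    (hadm2 : ∀ j : ZMod N₂, (l2 (j+1) - l2 j) = (l2 j - l2 (j-1)) ∨ |l2 j| = 1)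
    (c1 c2 : Fin C → ℝ)
    (hc1 : ∀ k, c1 k = 0 ∨ c1 k = 1 ∨ c1 k = -1)
    (hc2 : ∀ k, c2 k = 0 ∨ c2 k = 1 ∨ c2 k = -1)
    (z1 : Fin C → ZMod N₁ → ℝ)
    (hz1 : ∀ k i, z1 k i = if l0norm c1 = 0 then 0 else (c1 k / (l0norm c1 : ℝ)) * l1 i)
    (z2 : Fin C → ZMod N₂ → ℝ)
    (hz2 : ∀ k j, z2 k j = if l0norm c2 = 0 then 0 else (c2 k / (l0norm c2 : ℝ)) * l2 j)
    (u : Fin C → ZMod N₁ → ZMod N₂ → ℝ)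
    (hu : ∀ k i j, u k i j =
        DxT (fun i' _ => z1 k i') i j + DyT (fun _ j' => z2 k j') i j) :
    ∀ w : Fin C → ZMod N₁ → ZMod N₂ → ℝ,
      Jinf11 u + ∑ i, ∑ j, ∑ k, u k i j * (w k i j - u k i j) ≤ Jinf11 w := by
  intro w
  have hw : ∑ i, ∑ j, ∑ k, u k i j * w k i j ≤ Jinf11 w := by
    rw [aux_inner z1 z2 u w hu]
    refine Finset.sum_le_sum fun i _ => Finset.sum_le_sum fun j _ => add_le_add ?_ ?_
    · exact aux_le c1 hc1 (l1 i) (hl1 i) (fun k => z1 k i) (fun k => hz1 k i) _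
    · exact aux_le c2 hc2 (l2 j) (hl2 j) (fun k => z2 k j) (fun k => hz2 k j) _
  have huu : Jinf11 u ≤ ∑ i, ∑ j, ∑ k, u k i j * u k i j := by
    rw [aux_inner z1 z2 u u hu]
    refine Finset.sum_le_sum fun i _ => Finset.sum_le_sum fun j _ => add_le_add ?_ ?_
    · refine aux_ge hC c1 hc1 (l1 i) _ (aux_d l1 hl1 hadm1 i) (fun k => z1 k i) _
        (fun k => hz1 k i) fun k => ?_
      simp only [Dx, hu, DxT, DyT, hz1, sub_add_cancel]
      split_ifs <;> ring
    · refine aux_ge hC c2 hc2 (l2 j) _ (aux_d l2 hl2 hadm2 j) (fun k => z2 k j) _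
        (fun k => hz2 k j) fun k => ?_
      simp only [Dy, hu, DxT, DyT, hz2, sub_add_cancel]
      split_ifs <;> ring
  simp_rw [mul_sub, Finset.sum_sub_distrib]
  linarith
end
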